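/- arXiv:1007.4022 — 2 statements merged into one kernel-verified Lean document; each statement's English description precedes it below -/
import Mathlib

section
/- Let X be a finite set with #X ≥ 2, let w ∈ TS, and let α ∈ Aut F(X) satisfy α(w) = w. Then α is an inner automorphism of F(X). -/
/-! Common definitions: cyclic length, Whitehead automorphisms, the sets TS, TS', L(ε),
balls, and exponential genericity in the free group F(X). -/

/-- The cyclic length ‖w‖_X : the minimum of |g w g⁻¹|_X over g ∈ F(X). -/
noncomputable def cyclicLength {X : Type} [DecidableEq X] (w : FreeGroup X) : ℕ :=
  sInf (Set.range fun g : FreeGroup X => FreeGroup.norm (g * w * g⁻¹))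

/-- w is cyclically reduced if |w|_X = ‖w‖_X. -/
def CyclicallyReduced {X : Type} [DecidableEq X] (w : FreeGroup X) : Prop :=
  FreeGroup.norm w = cyclicLength w

/-- The set X^± = X ∪ X⁻¹ of letters, viewed inside F(X). -/
def Xpm (X : Type) : Set (FreeGroup X) :=
  (Set.range fun x : X => FreeGroup.of x) ∪ (Set.range fun x : X => (FreeGroup.of x)⁻¹)

/-- σ is a type I (relabeling) Whitehead automorphism: there is a bijection π of X^±
commuting with inversion such that σ(x) = π(x) for all x ∈ X. -/
def IsTypeI {X : Type} (σ : MulAut (FreeGroup X)) : Prop :=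
  ∃ π : FreeGroup X → FreeGroup X,
    Set.BijOn π (Xpm X) (Xpm X) ∧
    (∀ x ∈ Xpm X, π x⁻¹ = (π x)⁻¹) ∧
    (∀ x : X, σ (FreeGroup.of x) = π (FreeGroup.of x))

/-- σ is a type II Whitehead automorphism: there is a ∈ X^± with σ(a) = a and
σ(x) ∈ {x, xa, a⁻¹x, a⁻¹xa} for every x ∈ X^±. -/
def IsTypeII {X : Type} (σ : MulAut (FreeGroup X)) : Prop :=
  ∃ a ∈ Xpm X, σ a = a ∧
    ∀ x ∈ Xpm X, σ x = x ∨ σ x = x * a ∨ σ x = a⁻¹ * x ∨ σ x = a⁻¹ * x * a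

/-- σ is inner if it is conjugation by some element of F(X). -/
def IsInnerAut {X : Type} (σ : MulAut (FreeGroup X)) : Prop :=
  ∃ g : FreeGroup X, σ = MulAut.conj g

/-- w is a proper power if w = z^r for some z and some integer r ≥ 2. -/
def IsProperPower {X : Type} (w : FreeGroup X) : Prop :=
  ∃ z : FreeGroup X, ∃ r : ℕ, 2 ≤ r ∧ w = z ^ r

/-- TS is the set of cyclically reduced w that are not proper powers, whose cyclic length
is strictly increased by every non-inner type II Whitehead automorphism, and whose
conjugacy class is fixed by no non-identity type I Whitehead automorphism. -/
def TS (X : Type) [DecidableEq X] : Set (FreeGroup X) :=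
  {w | CyclicallyReduced w ∧ ¬ IsProperPower w ∧
    (∀ τ : MulAut (FreeGroup X), IsTypeII τ → ¬ IsInnerAut τ →
      cyclicLength w < cyclicLength (τ w)) ∧
    (∀ σ : MulAut (FreeGroup X), IsTypeI σ → σ ≠ 1 → ¬ IsConj w (σ w))}

/-- The set of elements of F(X) whose cyclic reduction lies in S. -/
def cyclicPreimage {X : Type} [DecidableEq X] (S : Set (FreeGroup X)) : Set (FreeGroup X) :=
  {w | ∃ g u : FreeGroup X, u ∈ S ∧ CyclicallyReduced u ∧ w = g * u * g⁻¹ ∧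
    FreeGroup.norm w = 2 * FreeGroup.norm g + FreeGroup.norm u}

/-- TS' is the set of elements of F(X) whose cyclic reduction lies in TS. -/
def TS' (X : Type) [DecidableEq X] : Set (FreeGroup X) :=
  cyclicPreimage (TS X)

/-- The ball B_n = {w ∈ F(X) : |w|_X ≤ n}. -/
def ballF (X : Type) [DecidableEq X] (n : ℕ) : Set (FreeGroup X) :=
  {w | FreeGroup.norm w ≤ n}

/-- S is exponentially T-generic: there are C > 0 and s ∈ (0,1) with
#((T∖S) ∩ B_n) ≤ C·s^n·#(T ∩ B_n) for all n. -/
def ExpGeneric {X : Type} [DecidableEq X] (S T : Set (FreeGroup X)) : Prop :=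
  ∃ C : ℝ, 0 < C ∧ ∃ s : ℝ, 0 < s ∧ s < 1 ∧
    ∀ n : ℕ, (((T \ S) ∩ ballF X n).ncard : ℝ) ≤ C * s ^ n * ((T ∩ ballF X n).ncard : ℝ)

/-- L(ε): the set of cyclically reduced w of length n ≥ 1 all of whose one-letter
frequencies lie in (1/(2N) − ε, 1/(2N) + ε) and all of whose cyclic two-letter
frequencies (for y ≠ x⁻¹) lie in (1/(2N(2N−1)) − ε, 1/(2N(2N−1)) + ε). -/
def Lset (X : Type) [Fintype X] [DecidableEq X] (ε : ℝ) : Set (FreeGroup X) :=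
  {w | CyclicallyReduced w ∧ 1 ≤ FreeGroup.norm w ∧
    ∀ x y : X × Bool, y ≠ (x.1, !x.2) →
      |((w.toWord.count x : ℝ) / (FreeGroup.norm w : ℝ)) -
        1 / (2 * (Fintype.card X : ℝ))| < ε ∧
      |(((w.toWord.zip (w.toWord.rotate 1)).count (x, y) : ℝ) / (FreeGroup.norm w : ℝ)) -
        1 / (2 * (Fintype.card X : ℝ) * (2 * (Fintype.card X : ℝ) - 1))| < ε}

namespace Whitehead

open FreeGroup Pointwise

variable {X : Type}

/-- The group element represented by a single letter. -/
def letter (a : X × Bool) : FreeGroup X := mk [a]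

/-- The inverse letter. -/
def flip (a : X × Bool) : X × Bool := (a.1, !a.2)

@[simp] lemma flip_flip (a : X × Bool) : flip (flip a) = a := by simp [flip]

lemma flip_ne (a : X × Bool) : flip a ≠ a := by
  intro h; have := congrArg Prod.snd h; simp [flip] at this

@[simp] lemma letter_flip (a : X × Bool) : letter (flip a) = (letter a)⁻¹ := by
  simp [letter, flip, invRev]

variable [DecidableEq X]

/-- The set of elements whose reduced word starts with the letter `a`. -/
def cone (a : X × Bool) : Set (FreeGroup X) := {g | g.toWord.head? = some a}

@[simp] lemma toWord_letter (a : X × Bool) : (letter a).toWord = [a] := by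
  simp [letter]

lemma one_notMem_cone (a : X × Bool) : (1 : FreeGroup X) ∉ cone a := by simp [cone]

lemma letter_mem_cone {a b : X × Bool} : letter a ∈ cone b ↔ a = b := by simp [cone]

lemma exists_mem_cone {g : FreeGroup X} (hg : g ≠ 1) : ∃ a, g ∈ cone a := by
  have : g.toWord ≠ [] := by simpa using hg
  obtain ⟨a, l, h⟩ := List.exists_cons_of_ne_nil this
  exact ⟨a, by simp [cone, h]⟩

lemma cone_unique {g : FreeGroup X} {a b : X × Bool} (ha : g ∈ cone a) (hb : g ∈ cone b) :
    a = b := by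
  simp only [cone, Set.mem_ofPred_eq] at ha hb
  rw [ha] at hb
  exact Option.some.inj hb

/-- Left multiplication by a letter that does not cancel. -/
lemma toWord_letter_mul {c : X × Bool} {g : FreeGroup X} (h : g ∉ cone (flip c)) :
    (letter c * g).toWord = c :: g.toWord := by
  rw [toWord_mul, toWord_letter, List.singleton_append, reduce.cons, reduce_toWord]
  cases hg : g.toWord with
  | nil => rfl
  | cons b t =>
    simp only [cone, hg, List.head?_cons, Set.mem_ofPred_eq, Option.some.injEq] at h
    have : ¬ (c.1 = b.1 ∧ c.2 = !b.2) := by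
      rintro ⟨h1, h2⟩
      exact h (Prod.ext h1.symm (by simp [flip, h2]))
    simp [this]

lemma cone_compl (a : X × Bool) : (cone a)ᶜ = letter a • cone (flip a) := by
  ext g
  rw [Set.mem_smul_set_iff_inv_smul_mem, smul_eq_mul, ← letter_flip]
  constructor
  · intro h
    have := toWord_letter_mul (c := flip a) (g := g) (by simpa only [flip_flip, Set.mem_compl_iff] using h)
    rw [cone, Set.mem_ofPred_eq, this]; rfl
  · intro h hg
    have h2 : letter (flip a) * g ∉ cone (flip a) := by
      intro h3
      have hw : g.toWord.head? = some a := hg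
      obtain ⟨t, ht⟩ : ∃ t, g.toWord = a :: t := by
        cases hg' : g.toWord with
        | nil => simp [hg'] at hw
        | cons b t => simp [hg'] at hw; exact ⟨t, by rw [hw]⟩
      have hred : IsReduced (a :: t) := ht ▸ isReduced_toWord
      have e : letter (flip a) * g = mk t := by
        have : g = mk (a :: t) := by rw [← ht, mk_toWord]
        rw [this, ← List.singleton_append, ← mul_mk, letter_flip, letter, inv_mul_cancel_left]
      have ht' : IsReduced t := hred.infix ⟨[a], [], by simp⟩
      rw [e] at h3
      simp only [cone, toWord_mk, ht'.reduce_eq, Set.mem_ofPred_eq] at h3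
      cases t with
      | nil => simp at h3
      | cons b t =>
        simp only [List.head?_cons, Option.some.injEq] at h3
        subst h3
        have := (List.isChain_cons_cons.1 hred).1
        simp [flip] at this
    exact h2 h

/-- Right multiplication by a letter changes membership in a cone only across its edge. -/
lemma mem_cone_mul_letter {g : FreeGroup X} {a c : X × Bool} (h1 : g ≠ 1)
    (h2 : g * letter c ≠ 1) : g ∈ cone a ↔ g * letter c ∈ cone a := by
  have h1' : g.toWord ≠ [] := by simpa using h1
  obtain ⟨l, b, hl⟩ : ∃ l b, g.toWord = l ++ [b] :=
    ⟨_, _, (List.dropLast_append_getLast h1').symm⟩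
  have hg : g = mk l * letter b := by rw [letter, mul_mk, ← hl, mk_toWord]
  have hred : IsReduced (l ++ [b]) := hl ▸ isReduced_toWord
  by_cases hb : b = flip c
  · have e : g * letter c = mk l := by rw [hg, hb]; simp
    have hlr : IsReduced l := hred.infix ⟨[], [b], by simp⟩
    have hw : (g * letter c).toWord = l := by rw [e, toWord_mk, hlr.reduce_eq]
    have hl0 : l ≠ [] := by
      rintro rfl
      exact h2 (by simpa using hw)
    simp [cone, hw, hl, List.head?_append_of_ne_nil _ hl0]
  · have hr : IsReduced (g.toWord ++ [c]) := by
      rw [hl, FreeGroup.IsReduced, List.isChain_append]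
      refine ⟨hred, by simp, ?_⟩
      simp only [List.getLast?_append, List.getLast?_singleton, Option.some_or, Option.mem_def,
        Option.some.injEq, List.head?_cons]
      rintro _ rfl _ rfl h
      by_contra h'
      exact hb (Prod.ext h (by rw [flip]; exact Bool.eq_not.2 h'))
    have hw : (g * letter c).toWord = g.toWord ++ [c] := by
      rw [toWord_mul, toWord_letter, hr.reduce_eq]
    simp [cone, hw, List.head?_append_of_ne_nil _ h1']

/-- The elements `g` such that the arc from `g` to `g * u` crosses the cut `S`. -/
def crossing (u : FreeGroup X) (S : Set (FreeGroup X)) : Set (FreeGroup X) :=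
  {g | ¬(g ∈ S ↔ g * u ∈ S)}

/-- The number of arcs from `g` to `g * u` crossing the cut `S`. -/
noncomputable def weight (u : FreeGroup X) (S : Set (FreeGroup X)) : ℕ := (crossing u S).ncard

omit [DecidableEq X] in
lemma crossing_compl (u : FreeGroup X) (S : Set (FreeGroup X)) :
    crossing u Sᶜ = crossing u S := by
  ext g; simp only [crossing, Set.mem_ofPred_eq, Set.mem_compl_iff]; tauto

omit [DecidableEq X] in
lemma crossing_smul (u g : FreeGroup X) (S : Set (FreeGroup X)) :
    crossing u (g • S) = g • crossing u S := by
  ext h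
  simp [crossing, Set.mem_smul_set_iff_inv_smul_mem, mul_assoc]

omit [DecidableEq X] in
lemma crossing_mul_subset (u v : FreeGroup X) (S : Set (FreeGroup X)) :
    crossing (u * v) S ⊆ crossing u S ∪ (· * u) ⁻¹' crossing v S := by
  intro g
  simp only [crossing, Set.mem_ofPred_eq, Set.mem_union, Set.mem_preimage, mul_assoc]
  tauto

/-- The crossing sets of a cone, for a single letter. -/
lemma crossing_letter_cone_subset (a c : X × Bool) :
    crossing (letter c) (cone a) ⊆ {1, letter (flip c)} := by
  intro g hg
  by_contra h
  simp only [Set.mem_insert_iff, Set.mem_singleton_iff, not_or, letter_flip] at h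
  exact hg (mem_cone_mul_letter h.1 fun h' => h.2 (eq_inv_of_mul_eq_one_left h'))

lemma crossing_letter_cone (a c : X × Bool) :
    crossing (letter c) (cone a) =
      {g | (g = 1 ∧ c = a) ∨ (g = letter (flip c) ∧ flip c = a)} := by
  ext g
  have hne : letter (flip c) ≠ 1 := by
    intro h
    have := congrArg toWord h
    rw [toWord_letter] at this
    simp at this
  constructor
  · intro hg
    rcases crossing_letter_cone_subset a c hg with rfl | rfl
    · left
      simpa [crossing, one_notMem_cone, letter_mem_cone] using hg
    · right
      rw [letter_flip] at hg
      refine ⟨rfl, ?_⟩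
      simp only [crossing, inv_mul_cancel, one_notMem_cone, Set.mem_ofPred_eq, iff_false,
        not_not] at hg
      rwa [← letter_flip, letter_mem_cone] at hg
  · rintro (⟨rfl, rfl⟩ | ⟨rfl, rfl⟩)
    · simp [crossing, one_notMem_cone, letter_mem_cone]
    · rw [letter_flip]
      simp only [crossing, inv_mul_cancel, one_notMem_cone, Set.mem_ofPred_eq, iff_false,
        not_not]
      rw [← letter_flip, letter_mem_cone]

lemma crossing_cone_cons {c : X × Bool} {v : FreeGroup X} (hv : v ∉ cone (flip c))
    (a : X × Bool) :
    crossing (letter c * v) (cone a) =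
      crossing (letter c) (cone a) ∪ (· * letter c) ⁻¹' crossing v (cone a) ∧
    Disjoint (crossing (letter c) (cone a)) ((· * letter c) ⁻¹' crossing v (cone a)) := by
  have hd : Disjoint (crossing (letter c) (cone a))
      ((· * letter c) ⁻¹' crossing v (cone a)) := by
    rw [Set.disjoint_left, crossing_letter_cone]
    rintro g (⟨rfl, rfl⟩ | ⟨rfl, rfl⟩) hg
    · have h1 : letter c * v ∈ cone c := by simp [cone, toWord_letter_mul hv]
      have h2 : letter c ∈ cone c := by simp [letter_mem_cone]
      simp [crossing, h1, h2] at hg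
    · simp [crossing, one_notMem_cone, hv] at hg
  refine ⟨?_, hd⟩
  apply Set.Subset.antisymm (crossing_mul_subset _ _ _)
  intro g hg
  rw [Set.disjoint_left] at hd
  have := @hd g
  simp only [crossing, Set.mem_ofPred_eq, Set.mem_union, Set.mem_preimage, mul_assoc] at *
  tauto

lemma crossing_cone_finite (u : FreeGroup X) (a : X × Bool) : (crossing u (cone a)).Finite := by
  have hl : ∀ c, (crossing (letter c) (cone a)).Finite := fun c =>
    Set.Finite.subset (by simp) (crossing_letter_cone_subset a c)
  have : ∀ L : List (X × Bool), (crossing (mk L) (cone a)).Finite := by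
    intro L
    induction L with
    | nil => simp [crossing, ← one_eq_mk]
    | cons c L ih =>
      rw [← List.singleton_append, ← mul_mk]
      exact ((hl c).union (ih.preimage (mul_left_injective _).injOn)).subset
        (crossing_mul_subset _ _ _)
  rw [← mk_toWord (x := u)]
  exact this _

lemma sum_weight_cone [Fintype X] (u : FreeGroup X) :
    ∑ x : X, weight u (cone (x, true)) = u.norm := by
  have : ∀ L : List (X × Bool), FreeGroup.IsReduced L →
      ∑ x : X, weight (mk L) (cone (x, true)) = L.length := by
    intro L
    induction L with
    | nil => intro _; simp [weight, crossing, ← one_eq_mk]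
    | cons c L ih =>
      intro hr
      have hLr : FreeGroup.IsReduced L := hr.infix ⟨[c], [], by simp⟩
      have hv : mk L ∉ cone (flip c) := by
        simp only [cone, toWord_mk, hLr.reduce_eq, Set.mem_ofPred_eq]
        cases L with
        | nil => simp
        | cons b t =>
          have := (List.isChain_cons_cons.1 hr).1
          simp only [List.head?_cons, Option.some.injEq]
          rintro rfl
          simp [flip] at this
      have hw : ∀ x : X, weight (mk (c :: L)) (cone (x, true)) =
          (if c.1 = x then 1 else 0) + weight (mk L) (cone (x, true)) := by
        intro x
        obtain ⟨h1, h2⟩ := crossing_cone_cons hv (x, true)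
        rw [← List.singleton_append, ← mul_mk]
        change (crossing (letter c * mk L) (cone (x, true))).ncard = _
        rw [h1, Set.ncard_union_eq h2 (crossing_cone_finite _ _)
          ((crossing_cone_finite _ _).preimage (mul_left_injective _).injOn)]
        congr 1
        · rw [crossing_letter_cone]
          obtain ⟨y, b⟩ := c
          cases b <;> by_cases hy : y = x <;> simp [flip, hy]
        · apply Set.ncard_preimage_of_injective_subset_range (mul_left_injective _)
          intro g _
          exact ⟨g * (letter c)⁻¹, by simp⟩
      simp_rw [hw]
      rw [Finset.sum_add_distrib, ih hLr]
      simp [add_comm]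
  rw [FreeGroup.norm, ← this _ isReduced_toWord, mk_toWord]

/-- Cones are connected. -/
lemma exists_edge_of_cone {S : Set (FreeGroup X)} {a : X × Bool} (h1 : (cone a ∩ S).Nonempty)
    (h2 : (cone a ∩ Sᶜ).Nonempty) :
    ∃ g c, g ∈ cone a ∧ g * letter c ∈ cone a ∧ g ∈ S ∧ g * letter c ∉ S := by
  by_contra! hno
  have hiff : ∀ g c, g ∈ cone a → g * letter c ∈ cone a → (g ∈ S ↔ g * letter c ∈ S) := by
    intro g c hg hgc
    refine ⟨hno g c hg hgc, fun h => ?_⟩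
    have := hno (g * letter c) (flip c) hgc (by simpa using hg) h
    simpa using this
  have key : ∀ t : List (X × Bool), FreeGroup.IsReduced (a :: t) →
      (mk (a :: t) ∈ S ↔ letter a ∈ S) := by
    intro t
    induction t using List.reverseRecOn with
    | nil => intro _; rfl
    | append_singleton t c ih =>
      intro hr
      have hr' : FreeGroup.IsReduced (a :: t) := hr.infix ⟨[], [c], by simp⟩
      have e : mk (a :: (t ++ [c])) = mk (a :: t) * letter c := by
        rw [letter, mul_mk]; rfl
      rw [← ih hr', e]
      refine (hiff _ _ ?_ ?_).symm
      · simp [cone, toWord_mk, hr'.reduce_eq]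
      · rw [← e]; simp [cone, toWord_mk, hr.reduce_eq]
  have key' : ∀ g ∈ cone a, (g ∈ S ↔ letter a ∈ S) := by
    intro g hg
    cases hg' : g.toWord with
    | nil => simp [cone, hg'] at hg
    | cons b t =>
      have hb : b = a := by simpa [cone, hg'] using hg
      subst hb
      rw [← mk_toWord (x := g), hg']
      exact key t (hg' ▸ isReduced_toWord)
  obtain ⟨g, hg, hgS⟩ := h1
  obtain ⟨g', hg', hgS'⟩ := h2
  exact hgS' ((key' _ hg').2 ((key' _ hg).1 hgS))

open Classical in
/-- Integer-valued indicator of a set. -/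
noncomputable def ind (S : Set (FreeGroup X)) (g : FreeGroup X) : ℤ := if g ∈ S then 1 else 0

omit [DecidableEq X] in
lemma ind_eq_iff {S T : Set (FreeGroup X)} {g h : FreeGroup X} :
    ind S g = ind T h ↔ (g ∈ S ↔ h ∈ T) := by
  unfold ind
  split_ifs <;> simp_all

omit [DecidableEq X] in
lemma ind_mem (S : Set (FreeGroup X)) (g : FreeGroup X) : ind S g = 0 ∨ ind S g = 1 := by
  unfold ind
  split_ifs <;> simp

/-- A set which contains or avoids each cone. -/
def IsStar (Z : Set (FreeGroup X)) : Prop := ∀ d, cone d ⊆ Z ∨ Disjoint (cone d) Z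

lemma IsStar.mem_iff {Z : Set (FreeGroup X)} (hZ : IsStar Z) {d : X × Bool} {g : FreeGroup X}
    (hg : g ∈ cone d) : g ∈ Z ↔ letter d ∈ Z := by
  have hd : letter d ∈ cone d := letter_mem_cone.2 rfl
  rcases hZ d with h | h
  · exact iff_of_true (h hg) (h hd)
  · exact iff_of_false (Set.disjoint_left.1 h hg) (Set.disjoint_left.1 h hd)

lemma isStar_cone (a : X × Bool) : IsStar (cone a) := by
  intro d
  by_cases h : d = a
  · left; rw [h]
  · right
    exact Set.disjoint_left.2 fun g h1 h2 => h (cone_unique h1 h2)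

lemma ind_cone_letter (a c : X × Bool) : ind (cone a) (letter c) = if c = a then 1 else 0 := by
  simp [ind, letter_mem_cone]

lemma IsStar.ind_mul_letter {Z : Set (FreeGroup X)} (hZ : IsStar Z) (h1 : 1 ∉ Z)
    (g : FreeGroup X) (c : X × Bool) :
    ind Z (g * letter c) = ind Z g + (if g = 1 then ind Z (letter c) else 0) -
      (if g = letter (flip c) then ind Z (letter (flip c)) else 0) := by
  have hne : (letter c : FreeGroup X) ≠ 1 := by
    intro h
    have := congrArg toWord h
    rw [toWord_letter] at this
    simp at this
  have hi1 : ind Z 1 = 0 := by simp [ind, h1]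
  by_cases hg : g = 1
  · subst hg
    have : (1 : FreeGroup X) ≠ letter (flip c) := by
      intro h
      rw [letter_flip, eq_comm, inv_eq_one] at h
      exact hne h
    rw [if_neg this]
    simp [hi1]
  by_cases hg' : g = letter (flip c)
  · subst hg'
    simp [hne, hi1]
  · obtain ⟨d, hd⟩ := exists_mem_cone hg
    have h2 : g * letter c ≠ 1 := fun h => hg' (by
      rw [letter_flip]; exact eq_inv_of_mul_eq_one_left h)
    have hd' := (mem_cone_mul_letter (a := d) hg h2).1 hd
    simp only [hg, hg', if_false, add_zero, sub_zero]
    rw [ind_eq_iff, hZ.mem_iff hd, hZ.mem_iff hd']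

omit [DecidableEq X] in
lemma eq_of_forall_mul_letter {f : FreeGroup X → ℤ} (hf : ∀ g c, f (g * letter c) = f g)
    (g : FreeGroup X) : f g = f 1 := by
  have : ∀ L : List (X × Bool), f (mk L) = f 1 := by
    intro L
    induction L using List.reverseRecOn with
    | nil => rfl
    | append_singleton L c ih => rw [← mul_mk, ← ih]; exact hf _ _
  obtain ⟨L, rfl⟩ := Quot.exists_rep g
  exact this L

/-- The endomorphism fixing the letter `a` and multiplying the other letters by powers of `a`. -/
def transvectHom (a : X × Bool) (n : X × Bool → ℤ) : FreeGroup X →* FreeGroup X :=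
  FreeGroup.lift fun x => if x = a.1 then of x else
    letter a ^ (-n (x, true)) * of x * letter a ^ n (x, false)

lemma transvectHom_letter_of_ne {a c : X × Bool} (n : X × Bool → ℤ) (h : c.1 ≠ a.1) :
    transvectHom a n (letter c) = letter a ^ (-n c) * letter c * letter a ^ n (flip c) := by
  obtain ⟨x, b⟩ := c
  have h' : x ≠ a.1 := h
  have ht : letter (x, true) = of x := rfl
  have hf : letter (x, false) = (of x)⁻¹ := rfl
  cases b
  · rw [hf, _root_.map_inv, transvectHom, lift_apply_of, if_neg h']
    simp [flip, mul_assoc]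
  · rw [ht, transvectHom, lift_apply_of, if_neg h']
    simp [flip]

lemma transvectHom_letter_of_eq {a c : X × Bool} (n : X × Bool → ℤ) (h : c.1 = a.1) :
    transvectHom a n (letter c) = letter c := by
  obtain ⟨x, b⟩ := c
  have h' : x = a.1 := h
  have ht : letter (x, true) = of x := rfl
  have hf : letter (x, false) = (of x)⁻¹ := rfl
  cases b
  · rw [hf, _root_.map_inv, transvectHom, lift_apply_of, if_pos h']
  · rw [ht, transvectHom, lift_apply_of, if_pos h']

lemma transvectHom_comp (a : X × Bool) (n : X × Bool → ℤ) :
    (transvectHom a n).comp (transvectHom a (-n)) = MonoidHom.id _ := by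
  ext x
  have ht : of x = letter (x, true) := rfl
  simp only [MonoidHom.comp_apply, MonoidHom.id_apply]
  by_cases h : x = a.1
  · rw [ht, transvectHom_letter_of_eq (c := (x, true)) _ h,
      transvectHom_letter_of_eq (c := (x, true)) _ h]
  · rw [ht, transvectHom_letter_of_ne (c := (x, true)) _ h, _root_.map_mul, _root_.map_mul,
      map_zpow, map_zpow, transvectHom_letter_of_eq _ rfl,
      transvectHom_letter_of_ne (c := (x, true)) _ h]
    simp [mul_assoc]

/-- The automorphism underlying `transvectHom`. -/
def transvect (a : X × Bool) (n : X × Bool → ℤ) : MulAut (FreeGroup X) :=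
  MonoidHom.toMulEquiv (transvectHom a n) (transvectHom a (-n))
    (by simpa using transvectHom_comp a (-n)) (transvectHom_comp a n)

lemma transvect_letter_of_ne {a c : X × Bool} (n : X × Bool → ℤ) (h : c.1 ≠ a.1) :
    transvect a n (letter c) = letter a ^ (-n c) * letter c * letter a ^ n (flip c) :=
  transvectHom_letter_of_ne n h

lemma transvect_letter_of_eq {a c : X × Bool} (n : X × Bool → ℤ) (h : c.1 = a.1) :
    transvect a n (letter c) = letter c :=
  transvectHom_letter_of_eq n h

omit [DecidableEq X] in
lemma mem_Xpm_iff {g : FreeGroup X} : g ∈ Xpm X ↔ ∃ c, g = letter c := by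
  constructor
  · rintro (⟨x, rfl⟩ | ⟨x, rfl⟩)
    · exact ⟨(x, true), rfl⟩
    · exact ⟨(x, false), rfl⟩
  · rintro ⟨⟨x, b⟩, rfl⟩
    cases b
    · exact Or.inr ⟨x, rfl⟩
    · exact Or.inl ⟨x, rfl⟩

lemma isTypeII_transvect {a : X × Bool} {n : X × Bool → ℤ} (hn : ∀ c, n c = 0 ∨ n c = 1) :
    IsTypeII (transvect a n) := by
  refine ⟨letter a, mem_Xpm_iff.2 ⟨a, rfl⟩, transvect_letter_of_eq n rfl, fun g hg => ?_⟩
  obtain ⟨c, rfl⟩ := mem_Xpm_iff.1 hg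
  by_cases h : c.1 = a.1
  · exact Or.inl (transvect_letter_of_eq n h)
  · rw [transvect_letter_of_ne n h]
    rcases hn c with h1 | h1 <;> rcases hn (flip c) with h2 | h2 <;> simp [h1, h2]

lemma ind_transvect {Z : Set (FreeGroup X)} (hZ : IsStar Z) (h1 : 1 ∉ Z) {a : X × Bool}
    (ha : letter a ∈ Z) (ha' : letter (flip a) ∉ Z) (g : FreeGroup X) :
    transvect a (fun c => ind Z (letter c)) g ∈ Z ↔ g ∈ cone a := by
  set τ := transvect a (fun c => ind Z (letter c)) with hτ
  have ia : ind Z (letter a) = 1 := by simp [ind, ha]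
  have ia' : ind Z (letter a)⁻¹ = 0 := by rw [← letter_flip, ind, if_neg ha']
  have hpos : ∀ (h : FreeGroup X) (k : ℤ), k = 0 ∨ k = 1 →
      ind Z (h * letter a ^ k) = ind Z h + if h = 1 then k else 0 := by
    rintro h k (rfl | rfl)
    · simp
    · rw [zpow_one, hZ.ind_mul_letter h1, letter_flip, ia, ia']; simp
  have hneg : ∀ (h : FreeGroup X) (k : ℤ), k = 0 ∨ k = 1 →
      ind Z (h * letter a ^ (-k)) = ind Z h - if h * letter a ^ (-k) = 1 then k else 0 := by
    intro h k hk
    have := hpos (h * letter a ^ (-k)) k hk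
    rw [zpow_neg, inv_mul_cancel_right] at this
    rw [zpow_neg, this]; ring
  have key := eq_of_forall_mul_letter (f := fun g => ind Z (τ g) - ind (cone a) g) ?_ g
  · have h0 : ind Z (τ 1) - ind (cone a) 1 = 0 := by simp [ind, h1, one_notMem_cone]
    simp only [h0] at key
    rw [← ind_eq_iff]; linarith
  intro g c
  simp only [_root_.map_mul]
  rw [(isStar_cone a).ind_mul_letter (one_notMem_cone a)]
  by_cases hc : c.1 = a.1
  · have hl : τ (letter c) = letter c := transvect_letter_of_eq _ hc
    have hl' : τ (letter (flip c)) = letter (flip c) := transvect_letter_of_eq _ hc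
    have e1 : τ g = 1 ↔ g = 1 := by simp
    have e2 : τ g = letter (flip c) ↔ g = letter (flip c) := by
      conv_lhs => rw [← hl']
      exact τ.injective.eq_iff
    have hcase : c = a ∨ c = flip a := by
      obtain ⟨x, b⟩ := c
      obtain ⟨y, b'⟩ := a
      cases b <;> cases b' <;> simp_all [flip]
    rw [hl, hZ.ind_mul_letter h1]
    simp only [e1, e2]
    have ia'' : ind Z (letter (flip a)) = 0 := by rw [letter_flip, ia']
    rcases hcase with rfl | rfl
    · rw [ind_cone_letter, ind_cone_letter, ia, ia'']; simp [flip_ne]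
    · rw [ind_cone_letter, ind_cone_letter, flip_flip, ia, ia'']; simp [flip_ne]
  · have hca : c ≠ a := fun h => hc (by rw [h])
    have hca' : flip c ≠ a := fun h => hc (by rw [← h]; rfl)
    rw [ind_cone_letter, ind_cone_letter, if_neg hca, if_neg hca', transvect_letter_of_ne _ hc,
      ← mul_assoc, ← mul_assoc, hpos _ _ (ind_mem _ _), hZ.ind_mul_letter h1,
      hneg _ _ (ind_mem _ _)]
    have : τ g * letter a ^ (-ind Z (letter c)) * letter c = 1 ↔
        τ g * letter a ^ (-ind Z (letter c)) = letter (flip c) := by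
      rw [letter_flip, mul_eq_one_iff_eq_inv]
    simp only [this]
    simp

lemma ind_transvect_of_ne {Z : Set (FreeGroup X)} {a : X × Bool} {x : X} (hx : x ≠ a.1)
    (g : FreeGroup X) :
    letter a ^ (ind Z (letter (x, true))) * transvect a (fun c => ind Z (letter c)) g ∈
      cone (x, true) ↔ g ∈ cone (x, true) := by
  set τ := transvect a (fun c => ind Z (letter c)) with hτ
  set p := letter a ^ (ind Z (letter (x, true))) with hp
  have hxa : ∀ b, a ≠ (x, b) := by rintro b rfl; exact hx rfl
  have hxa' : ∀ b, flip a ≠ (x, b) := by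
    intro b h
    exact hx (congrArg Prod.fst h).symm
  have hst := fun h c => (isStar_cone (x, true)).ind_mul_letter (one_notMem_cone _) h c
  have hmul : ∀ (h : FreeGroup X), ind (cone (x, true)) (h * letter a) =
      ind (cone (x, true)) h := by
    intro h
    rw [hst, ind_cone_letter, ind_cone_letter, if_neg (hxa _), if_neg (hxa' _)]; simp
  have hpos : ∀ (h : FreeGroup X) (k : ℤ), k = 0 ∨ k = 1 →
      ind (cone (x, true)) (h * letter a ^ k) = ind (cone (x, true)) h := by
    rintro h k (rfl | rfl)
    · simp
    · rw [zpow_one, hmul]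
  have hneg : ∀ (h : FreeGroup X) (k : ℤ), k = 0 ∨ k = 1 →
      ind (cone (x, true)) (h * letter a ^ (-k)) = ind (cone (x, true)) h := by
    intro h k hk
    rw [← hpos (h * letter a ^ (-k)) k hk, zpow_neg, inv_mul_cancel_right]
  have key := eq_of_forall_mul_letter
    (f := fun g => ind (cone (x, true)) (p * τ g) - ind (cone (x, true)) g) ?_ g
  · have h0 : ind (cone (x, true)) (p * τ 1) - ind (cone (x, true)) 1 = 0 := by
      rw [_root_.map_one, ← one_mul (p * 1), mul_one, hp, hpos _ _ (ind_mem _ _), sub_self]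
    simp only [h0] at key
    rw [← ind_eq_iff]; linarith
  intro g c
  simp only [_root_.map_mul]
  rw [hst g c]
  by_cases hc : c.1 = a.1
  · have hl : τ (letter c) = letter c := transvect_letter_of_eq _ hc
    have hcx : c ≠ (x, true) := by rintro rfl; exact hx hc
    have hcx' : flip c ≠ (x, true) := by
      intro h
      exact hx ((congrArg Prod.fst h).symm.trans hc)
    rw [hl, ← mul_assoc, hst, ind_cone_letter, ind_cone_letter, if_neg hcx, if_neg hcx']
    simp
  · rw [transvect_letter_of_ne _ hc, ← mul_assoc, ← mul_assoc, ← mul_assoc,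
      hpos _ _ (ind_mem _ _), hst, hneg _ _ (ind_mem _ _)]
    have e1 : c = (x, true) → (p * τ g * letter a ^ (-ind Z (letter c)) = 1 ↔ g = 1) := by
      rintro rfl
      rw [zpow_neg, ← hp, mul_inv_eq_one, mul_eq_left]
      simp
    have e2 : flip c = (x, true) → (p * τ g * letter a ^ (-ind Z (letter c)) = letter (flip c) ↔
        g = letter (flip c)) := by
      intro h
      have h3 : τ (letter (flip c)) = letter a ^ (-ind Z (letter (flip c))) * letter (flip c) *
          letter a ^ (ind Z (letter (flip (flip c)))) :=
        transvect_letter_of_ne _ hc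
      rw [← τ.injective.eq_iff (a := g), h3, flip_flip, hp, ← h, zpow_neg, zpow_neg]
      constructor
      · intro h4
        have h5 := eq_mul_of_mul_inv_eq h4
        rw [← eq_inv_mul_iff_mul_eq] at h5
        rw [h5, mul_assoc]
      · intro h4
        rw [h4]; group
    rw [ind_cone_letter, ind_cone_letter]
    by_cases hc1 : c = (x, true)
    · have hc2 : flip c ≠ (x, true) := by rw [hc1]; exact flip_ne _
      simp only [e1 hc1, if_neg hc2]; simp
    · by_cases hc2 : flip c = (x, true)
      · simp only [e2 hc2, if_neg hc1]; simp
      · simp only [if_neg hc1, if_neg hc2]; simp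

/-- Two cuts are equivalent if they agree up to translation and complement. -/
def CutEquiv (A B : Set (FreeGroup X)) : Prop := ∃ g : FreeGroup X, A = g • B ∨ A = g • Bᶜ

omit [DecidableEq X] in
lemma CutEquiv.refl (A : Set (FreeGroup X)) : CutEquiv A A := ⟨1, by simp⟩

omit [DecidableEq X] in
lemma CutEquiv.symm {A B : Set (FreeGroup X)} (h : CutEquiv A B) : CutEquiv B A := by
  obtain ⟨g, rfl | rfl⟩ := h
  · exact ⟨g⁻¹, by simp⟩
  · exact ⟨g⁻¹, by simp [← Set.smul_set_compl]⟩

omit [DecidableEq X] in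
lemma CutEquiv.trans {A B C : Set (FreeGroup X)} (h : CutEquiv A B) (h' : CutEquiv B C) :
    CutEquiv A C := by
  obtain ⟨g, rfl | rfl⟩ := h <;> obtain ⟨g', rfl | rfl⟩ := h' <;>
    exact ⟨g * g', by simp [mul_smul, Set.smul_set_compl]⟩

omit [DecidableEq X] in
lemma CutEquiv.smul (g : FreeGroup X) (A : Set (FreeGroup X)) : CutEquiv (g • A) A :=
  ⟨g, Or.inl rfl⟩

omit [DecidableEq X] in
lemma CutEquiv.compl (A : Set (FreeGroup X)) : CutEquiv Aᶜ A := ⟨1, by simp⟩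

omit [DecidableEq X] in
lemma CutEquiv.crossing_finite {A B : Set (FreeGroup X)} (h : CutEquiv A B) {u : FreeGroup X}
    (hB : (crossing u B).Finite) : (crossing u A).Finite := by
  obtain ⟨g, rfl | rfl⟩ := h
  · rw [crossing_smul]; exact hB.smul_set
  · rw [crossing_smul, crossing_compl]; exact hB.smul_set

omit [DecidableEq X] in
lemma CutEquiv.weight_eq {A B : Set (FreeGroup X)} (h : CutEquiv A B) (u : FreeGroup X) :
    weight u A = weight u B := by
  obtain ⟨g, rfl | rfl⟩ := h
  · rw [weight, weight, crossing_smul, Set.ncard_smul_set]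
  · rw [weight, weight, crossing_smul, crossing_compl, Set.ncard_smul_set]

/-- The image of a cone under an automorphism. -/
def autCone (β : MulAut (FreeGroup X)) (a : X × Bool) : Set (FreeGroup X) :=
  {h | β⁻¹ h ∈ cone a}

/-- The half-spaces of the Cayley tree of the basis `β(X)`. -/
def halfSpaces (β : MulAut (FreeGroup X)) : Set (Set (FreeGroup X)) :=
  {A | ∃ (g : FreeGroup X) (a : X × Bool), A = g • autCone β a}

lemma autCone_compl (β : MulAut (FreeGroup X)) (a : X × Bool) :
    (autCone β a)ᶜ = β (letter a) • autCone β (flip a) := by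
  ext h
  have := Set.ext_iff.1 (cone_compl a) (β⁻¹ h)
  simpa [autCone, Set.mem_smul_set_iff_inv_smul_mem] using this

lemma smul_mem_halfSpaces {β : MulAut (FreeGroup X)} {A : Set (FreeGroup X)}
    (h : A ∈ halfSpaces β) (g : FreeGroup X) : g • A ∈ halfSpaces β := by
  obtain ⟨g', a, rfl⟩ := h
  exact ⟨g * g', a, by rw [mul_smul]⟩

lemma compl_mem_halfSpaces {β : MulAut (FreeGroup X)} {A : Set (FreeGroup X)}
    (h : A ∈ halfSpaces β) : Aᶜ ∈ halfSpaces β := by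
  obtain ⟨g', a, rfl⟩ := h
  exact ⟨g' * β (letter a), flip a, by rw [mul_smul, ← autCone_compl, Set.smul_set_compl]⟩

lemma autCone_mem_halfSpaces (β : MulAut (FreeGroup X)) (a : X × Bool) :
    autCone β a ∈ halfSpaces β := ⟨1, a, by simp⟩

lemma CutEquiv.mem_halfSpaces {β : MulAut (FreeGroup X)} {A B : Set (FreeGroup X)}
    (h : CutEquiv A B) (hB : B ∈ halfSpaces β) : A ∈ halfSpaces β := by
  obtain ⟨g, rfl | rfl⟩ := h
  · exact smul_mem_halfSpaces hB g
  · exact smul_mem_halfSpaces (compl_mem_halfSpaces hB) g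

lemma autCone_cutEquiv (β : MulAut (FreeGroup X)) (a : X × Bool) :
    CutEquiv (autCone β a) (autCone β (a.1, true)) := by
  obtain ⟨x, b⟩ := a
  cases b
  · have := autCone_compl β (x, true)
    exact (CutEquiv.smul _ _).symm.trans (this ▸ CutEquiv.compl _)
  · exact CutEquiv.refl _

lemma mem_halfSpaces_iff {β : MulAut (FreeGroup X)} {A : Set (FreeGroup X)} :
    A ∈ halfSpaces β ↔ ∃ x, CutEquiv A (autCone β (x, true)) := by
  constructor
  · rintro ⟨g, a, rfl⟩
    exact ⟨a.1, (CutEquiv.smul _ _).trans (autCone_cutEquiv β a)⟩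
  · rintro ⟨x, h⟩
    exact h.mem_halfSpaces (autCone_mem_halfSpaces _ _)

lemma crossing_autCone (β : MulAut (FreeGroup X)) (u : FreeGroup X) (a : X × Bool) :
    crossing u (autCone β a) = β '' crossing (β⁻¹ u) (cone a) := by
  ext h
  constructor
  · intro hh
    exact ⟨β⁻¹ h, by simpa [crossing, autCone] using hh, by simp⟩
  · rintro ⟨k, hk, rfl⟩
    simpa [crossing, autCone] using hk

lemma crossing_finite_of_mem_halfSpaces {β : MulAut (FreeGroup X)} {A : Set (FreeGroup X)}
    (h : A ∈ halfSpaces β) (u : FreeGroup X) : (crossing u A).Finite := by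
  obtain ⟨x, h⟩ := mem_halfSpaces_iff.1 h
  refine h.crossing_finite ?_
  rw [crossing_autCone]
  exact (crossing_cone_finite _ _).image _

lemma sum_weight_autCone [Fintype X] (β : MulAut (FreeGroup X)) (u : FreeGroup X) :
    ∑ x : X, weight u (autCone β (x, true)) = (β⁻¹ u).norm := by
  rw [← sum_weight_cone]
  refine Finset.sum_congr rfl fun x _ => ?_
  rw [weight, weight, crossing_autCone, Set.ncard_image_of_injective _ β.injective]

/-- A set which contains or avoids each of the translated cones at the identity. -/
def IsStarFor (β : MulAut (FreeGroup X)) (Z : Set (FreeGroup X)) : Prop :=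
  ∀ d, autCone β d ⊆ Z ∨ Disjoint (autCone β d) Z

lemma IsStarFor.compl {β : MulAut (FreeGroup X)} {Z : Set (FreeGroup X)} (h : IsStarFor β Z) :
    IsStarFor β Zᶜ := by
  intro d
  rcases h d with h | h
  · exact Or.inr (Set.disjoint_compl_right_iff_subset.2 h)
  · exact Or.inl (Set.subset_compl_iff_disjoint_right.2 h)

lemma IsStarFor.isStar {β : MulAut (FreeGroup X)} {Z : Set (FreeGroup X)} (h : IsStarFor β Z) :
    IsStar (β ⁻¹' Z) := by
  intro d
  rcases h d with h | h
  · exact Or.inl fun g hg => h (by simpa [autCone] using hg)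
  · exact Or.inr (Set.disjoint_left.2 fun g hg =>
      Set.disjoint_left.1 h (by simpa [autCone] using hg))

/-- Replacing one element of a basis, by a Whitehead automorphism, along a star cut. -/
lemma exists_isTypeII_replace {β : MulAut (FreeGroup X)} {Z : Set (FreeGroup X)}
    (hZ : IsStarFor β Z) {a : X × Bool} (ha : β (letter a) ∈ Z ↔ β (letter (flip a)) ∉ Z) :
    ∃ τ : MulAut (FreeGroup X), IsTypeII τ ∧ CutEquiv (autCone (β * τ) (a.1, true)) Z ∧
      ∀ x, x ≠ a.1 → CutEquiv (autCone (β * τ) (x, true)) (autCone β (x, true)) := by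
  wlog h1 : 1 ∉ Z generalizing Z
  · have h1' : 1 ∉ Zᶜ := by simpa using h1
    obtain ⟨τ, hτ, h2, h3⟩ := this hZ.compl (by simp only [Set.mem_compl_iff]; tauto) h1'
    exact ⟨τ, hτ, h2.trans (CutEquiv.compl _), h3⟩
  wlog ha1 : β (letter a) ∈ Z generalizing a
  · exact this (a := flip a) (by rw [flip_flip]; tauto) (by tauto)
  set Y := β ⁻¹' Z with hY
  have h1Y : (1 : FreeGroup X) ∉ Y := by simpa [hY] using h1
  set n := fun c => ind Y (letter c) with hn
  refine ⟨transvect a n, isTypeII_transvect fun c => ind_mem _ _, ?_, ?_⟩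
  · refine (autCone_cutEquiv _ a).symm.trans ⟨1, Or.inl ?_⟩
    ext h
    have := ind_transvect hZ.isStar h1Y (a := a) ha1 (ha.1 ha1) ((transvect a n)⁻¹ (β⁻¹ h))
    rw [MulAut.apply_inv_self] at this
    rw [one_smul, autCone, Set.mem_ofPred_eq, mul_inv_rev, MulAut.mul_apply, ← this]
    simp
  · intro x hx
    refine ⟨β (letter a ^ ind Y (letter (x, true)))⁻¹, Or.inl ?_⟩
    ext h
    have := ind_transvect_of_ne (Z := Y) hx ((transvect a n)⁻¹ (β⁻¹ h))
    rw [MulAut.apply_inv_self] at this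
    rw [autCone, Set.mem_ofPred_eq, mul_inv_rev, MulAut.mul_apply, ← this,
      Set.mem_smul_set_iff_inv_smul_mem]
    simp [autCone]


/-- Two sets cross if all four corners are nonempty. -/
def Cross (A B : Set (FreeGroup X)) : Prop :=
  (A ∩ B).Nonempty ∧ (A ∩ Bᶜ).Nonempty ∧ (Aᶜ ∩ B).Nonempty ∧ (Aᶜ ∩ Bᶜ).Nonempty

section
omit [DecidableEq X]

lemma Cross.symm {A B : Set (FreeGroup X)} (h : Cross A B) : Cross B A := by
  obtain ⟨h1, h2, h3, h4⟩ := h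
  exact ⟨Set.inter_comm A B ▸ h1, Set.inter_comm Aᶜ B ▸ h3, Set.inter_comm A Bᶜ ▸ h2,
    Set.inter_comm Aᶜ Bᶜ ▸ h4⟩

lemma cross_comm {A B : Set (FreeGroup X)} : Cross A B ↔ Cross B A := ⟨Cross.symm, Cross.symm⟩

lemma cross_compl_right {A B : Set (FreeGroup X)} : Cross A Bᶜ ↔ Cross A B := by
  simp only [Cross, compl_compl]; tauto

lemma cross_smul {A B : Set (FreeGroup X)} (g : FreeGroup X) :
    Cross (g • A) (g • B) ↔ Cross A B := by
  simp only [Cross, ← Set.smul_set_compl, ← Set.smul_set_inter, Set.smul_set_nonempty]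

lemma not_cross_iff {A B : Set (FreeGroup X)} :
    ¬ Cross A B ↔ A ⊆ Bᶜ ∨ A ⊆ B ∨ B ⊆ A ∨ Bᶜ ⊆ A := by
  have h1 : A ⊆ Bᶜ ↔ ¬ (A ∩ B).Nonempty := by
    rw [Set.not_nonempty_iff_eq_empty, ← Set.disjoint_iff_inter_eq_empty,
      Set.subset_compl_iff_disjoint_right]
  have h2 : A ⊆ B ↔ ¬ (A ∩ Bᶜ).Nonempty := by
    rw [Set.inter_compl_nonempty_iff, not_not]
  have h3 : B ⊆ A ↔ ¬ (Aᶜ ∩ B).Nonempty := by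
    rw [Set.inter_comm, Set.inter_compl_nonempty_iff, not_not]
  have h4 : Bᶜ ⊆ A ↔ ¬ (Aᶜ ∩ Bᶜ).Nonempty := by
    rw [Set.inter_comm, Set.inter_compl_nonempty_iff, not_not]
  rw [h1, h2, h3, h4, Cross]; tauto

/-- A set nested with both members of a crossing pair is nested with their corners. -/
lemma Cross.not_cross_inter {B' B C : Set (FreeGroup X)} (hBC : Cross C B) (h1 : ¬ Cross B' C)
    (h2 : ¬ Cross B' B) : ¬ Cross B' (C ∩ B) := by
  rw [not_cross_iff] at h1 h2 ⊢
  obtain ⟨⟨p, hp⟩, ⟨q, hq⟩, ⟨r, hr⟩, ⟨s, hs⟩⟩ := hBC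
  simp only [Set.mem_inter_iff, Set.mem_compl_iff] at hp hq hr hs
  simp only [Set.subset_def, Set.mem_inter_iff, Set.mem_compl_iff] at h1 h2 ⊢
  rcases h1 with h1 | h1 | h1 | h1
  · left; intro x hx h; exact h1 x hx h.1
  · rcases h2 with h2 | h2 | h2 | h2
    · left; intro x hx h; exact h2 x hx h.2
    · right; left; intro x hx; exact ⟨h1 x hx, h2 x hx⟩
    · right; right; left; intro x hx; exact h2 x hx.2
    · exact absurd (h1 s (h2 s hs.2)) hs.1
  · right; right; left; intro x hx; exact h1 x hx.1
  · rcases h2 with h2 | h2 | h2 | h2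
    · left; intro x hx h; exact h2 x hx h.2
    · exact absurd (h2 s (h1 s hs.1)) hs.2
    · right; right; left; intro x hx; exact h2 x hx.2
    · right; right; right; intro x hx
      by_cases hxC : x ∈ C
      · exact h2 x fun h => hx ⟨hxC, h⟩
      · exact h1 x hxC

end

lemma exists_edge_of_mem_halfSpaces {β : MulAut (FreeGroup X)} {A S : Set (FreeGroup X)}
    (hA : A ∈ halfSpaces β) (h1 : (A ∩ S).Nonempty) (h2 : (A ∩ Sᶜ).Nonempty) :
    ∃ g c, g ∈ A ∧ g * β (letter c) ∈ A ∧ g ∈ S ∧ g * β (letter c) ∉ S := by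
  obtain ⟨k, a, rfl⟩ := hA
  have hmem : ∀ h, h ∈ k • autCone β a ↔ β⁻¹ (k⁻¹ * h) ∈ cone a := by
    intro h; rw [Set.mem_smul_set_iff_inv_smul_mem]; rfl
  obtain ⟨g, c, e1, e2, e3, e4⟩ := exists_edge_of_cone (a := a) (S := {h | k * β h ∈ S})
    (by obtain ⟨h, hh, hS⟩ := h1; exact ⟨β⁻¹ (k⁻¹ * h), (hmem h).1 hh, by simpa using hS⟩)
    (by obtain ⟨h, hh, hS⟩ := h2; exact ⟨β⁻¹ (k⁻¹ * h), (hmem h).1 hh, by simpa using hS⟩)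
  refine ⟨k * β g, c, (hmem _).2 (by simpa using e1), (hmem _).2 ?_, e3, ?_⟩
  · simpa [mul_assoc] using e2
  · simpa [mul_assoc] using e4

lemma edge_eq {β : MulAut (FreeGroup X)} {k g : FreeGroup X} {a c : X × Bool}
    (h1 : g ∈ k • autCone β a) (h2 : g * β (letter c) ∉ k • autCone β a) :
    g = k * β (letter a) ∧ g * β (letter c) = k := by
  have hmem : ∀ h, h ∈ k • autCone β a ↔ β⁻¹ (k⁻¹ * h) ∈ cone a := by
    intro h; rw [Set.mem_smul_set_iff_inv_smul_mem]; rfl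
  rw [hmem] at h1 h2
  have h2' : β⁻¹ (k⁻¹ * g) * letter c ∉ cone a := by simpa [← mul_assoc] using h2
  have h : β⁻¹ (k⁻¹ * g) ∈ crossing (letter c) (cone a) := fun h => h2' (h.1 h1)
  rw [crossing_letter_cone] at h
  rcases h with ⟨h, -⟩ | ⟨h, h'⟩
  · rw [h] at h1; exact absurd h1 (one_notMem_cone a)
  · have e : k⁻¹ * g = β (letter (flip c)) := by rw [← h, MulAut.apply_inv_self]
    rw [inv_mul_eq_iff_eq_mul] at e
    rw [e, h']
    refine ⟨rfl, ?_⟩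
    rw [← h', letter_flip]; simp [mul_assoc]

/-- The half-spaces of a basis are pairwise nested. -/
lemma not_cross_of_mem_halfSpaces {β : MulAut (FreeGroup X)} {A B : Set (FreeGroup X)}
    (hA : A ∈ halfSpaces β) (hB : B ∈ halfSpaces β) : ¬ Cross A B := by
  intro h
  obtain ⟨h1, h2, h3, h4⟩ := h.symm
  obtain ⟨g, c, e1, e2, e3, e4⟩ := exists_edge_of_mem_halfSpaces hB h1 h2
  obtain ⟨g', c', f1, f2, f3, f4⟩ := exists_edge_of_mem_halfSpaces (compl_mem_halfSpaces hB) h3 h4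
  obtain ⟨k, a, rfl⟩ := hA
  rw [(edge_eq e3 e4).1] at e1
  rw [(edge_eq f3 f4).1] at f1
  exact f1 e1

lemma finite_setOf_cross [Finite X] {γ : MulAut (FreeGroup X)} {A B : Set (FreeGroup X)}
    (hA : ∀ u, (crossing u A).Finite) (hB : B ∈ halfSpaces γ) :
    {g : FreeGroup X | Cross A (g • B)}.Finite := by
  set V : Set (FreeGroup X) := ⋃ c : X × Bool, crossing (γ (letter c)) A with hV
  have hVf : V.Finite := Set.finite_iUnion fun c => hA _
  have hfin : (⋃ h ∈ V, ⋃ h' ∈ V, (fun k => h * k⁻¹) '' crossing (h⁻¹ * h') B).Finite :=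
    hVf.biUnion fun h _ => hVf.biUnion fun h' _ =>
      (crossing_finite_of_mem_halfSpaces hB _).image _
  refine hfin.subset fun g hg => ?_
  obtain ⟨h1, h2, h3, h4⟩ := Cross.symm hg
  have hgB := smul_mem_halfSpaces hB g
  obtain ⟨p, c, e1, e2, e3, e4⟩ := exists_edge_of_mem_halfSpaces hgB h1 h2
  obtain ⟨q, d, f1, f2, f3, f4⟩ := exists_edge_of_mem_halfSpaces (compl_mem_halfSpaces hgB) h3 h4
  have hp : p ∈ V := Set.mem_iUnion.2 ⟨c, fun h => e4 (h.1 e3)⟩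
  have hq : q ∈ V := Set.mem_iUnion.2 ⟨d, fun h => f4 (h.1 f3)⟩
  rw [Set.mem_smul_set_iff_inv_smul_mem] at e1
  rw [Set.mem_compl_iff, Set.mem_smul_set_iff_inv_smul_mem] at f1
  refine Set.mem_biUnion hp (Set.mem_biUnion hq ⟨g⁻¹ * p, fun h => f1 ?_, by simp⟩)
  simpa [mul_assoc] using h.1 e1

/-- The number of translates of `B` crossing `A`. -/
noncomputable def crossNum (A B : Set (FreeGroup X)) : ℕ :=
  {g : FreeGroup X | Cross A (g • B)}.ncard

section
omit [DecidableEq X]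

lemma crossNum_comm (A B : Set (FreeGroup X)) : crossNum A B = crossNum B A := by
  have : {g : FreeGroup X | Cross B (g • A)} = {g : FreeGroup X | Cross A (g • B)}⁻¹ := by
    ext g
    rw [Set.mem_inv, Set.mem_ofPred_eq, Set.mem_ofPred_eq, cross_comm (A := B),
      ← cross_smul (A := g • A) g⁻¹, inv_smul_smul]
  rw [crossNum, crossNum, this, Set.ncard_inv]

lemma CutEquiv.crossNum_right {A B C : Set (FreeGroup X)} (h : CutEquiv B C) :
    crossNum A B = crossNum A C := by
  obtain ⟨k, hk⟩ := h
  have : {g : FreeGroup X | Cross A (g • C)} =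
      (fun g => g * k) '' {g : FreeGroup X | Cross A (g • B)} := by
    ext g
    rw [Set.image_mul_right, Set.mem_preimage]
    rcases hk with rfl | rfl
    · simp [smul_smul]
    · simp [smul_smul, Set.smul_set_compl, cross_compl_right]
  rw [crossNum, crossNum, this, Set.ncard_image_of_injective _ (mul_left_injective k)]

lemma CutEquiv.crossNum_left {A B C : Set (FreeGroup X)} (h : CutEquiv A B) :
    crossNum A C = crossNum B C := by
  rw [crossNum_comm, h.crossNum_right, crossNum_comm]

end

/-- The number of crossings of a cut with the half-spaces of a basis. -/
noncomputable def totalCross [Fintype X] (γ : MulAut (FreeGroup X)) (A : Set (FreeGroup X)) : ℕ :=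
  ∑ y : X, crossNum A (autCone γ (y, true))

lemma CutEquiv.totalCross_eq [Fintype X] {γ : MulAut (FreeGroup X)} {A B : Set (FreeGroup X)}
    (h : CutEquiv A B) : totalCross γ A = totalCross γ B :=
  Finset.sum_congr rfl fun _ _ => h.crossNum_left

open Classical in
/-- The number of orbits of half-spaces of `β` which are not half-spaces of `γ`. -/
noncomputable def badNum [Fintype X] (β γ : MulAut (FreeGroup X)) : ℕ :=
  ∑ x : X, if autCone β (x, true) ∈ halfSpaces γ then 0 else 1

/-- The distance between two bases that decreases along the surgery. -/
noncomputable def potential [Fintype X] (β γ : MulAut (FreeGroup X)) : ℕ :=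
  ∑ x : X, totalCross γ (autCone β (x, true)) + badNum β γ + badNum γ β

lemma potential_comm [Fintype X] (β γ : MulAut (FreeGroup X)) :
    potential β γ = potential γ β := by
  have : ∑ x : X, totalCross γ (autCone β (x, true)) =
      ∑ x : X, totalCross β (autCone γ (x, true)) := by
    unfold totalCross
    rw [Finset.sum_comm]
    exact Finset.sum_congr rfl fun _ _ => Finset.sum_congr rfl fun _ _ => crossNum_comm _ _
  rw [potential, potential, this]; ring

/-- `β` can be moved closer to `γ` by a Whitehead automorphism not increasing the length of `w`. -/
def CanStep [Fintype X] (w : FreeGroup X) (β γ : MulAut (FreeGroup X)) : Prop :=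
  ∃ τ : MulAut (FreeGroup X), IsTypeII τ ∧ ((β * τ)⁻¹ w).norm ≤ (β⁻¹ w).norm ∧
    potential (β * τ) γ < potential β γ

lemma canStep_of_star [Fintype X] {w : FreeGroup X} {β γ : MulAut (FreeGroup X)}
    {Z : Set (FreeGroup X)} (hZ : IsStarFor β Z) {a : X × Bool}
    (ha : β (letter a) ∈ Z ↔ β (letter (flip a)) ∉ Z)
    (hw : weight w Z ≤ weight w (autCone β a)) (hbad : autCone β a ∉ halfSpaces γ)
    (hc : totalCross γ Z < totalCross γ (autCone β a) ∨
      (totalCross γ Z ≤ totalCross γ (autCone β a) ∧ Z ∈ halfSpaces γ)) :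
    CanStep w β γ := by
  classical
  obtain ⟨τ, hτ, h1, h2⟩ := exists_isTypeII_replace hZ ha
  have hae := autCone_cutEquiv β a
  rw [hae.weight_eq] at hw
  rw [hae.totalCross_eq] at hc
  have hbad' : autCone β (a.1, true) ∉ halfSpaces γ := fun h => hbad (hae.mem_halfSpaces h)
  have key : ∀ f : Set (FreeGroup X) → ℕ, (∀ A B, CutEquiv A B → f A = f B) →
      ∑ x, f (autCone (β * τ) (x, true)) + f (autCone β (a.1, true)) =
        ∑ x, f (autCone β (x, true)) + f Z := by
    intro f hf
    rw [← Finset.add_sum_erase _ _ (Finset.mem_univ a.1), hf _ _ h1,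
      ← Finset.add_sum_erase Finset.univ (fun x => f (autCone β (x, true))) (Finset.mem_univ a.1),
      Finset.sum_congr rfl fun x hx => hf _ _ (h2 x (Finset.ne_of_mem_erase hx))]
    ring
  refine ⟨τ, hτ, ?_, ?_⟩
  · rw [← sum_weight_autCone, ← sum_weight_autCone]
    have := key (weight w) fun A B h => h.weight_eq w
    omega
  · have k1 := key (totalCross γ) fun A B h => h.totalCross_eq
    have k2 := key (fun A => if A ∈ halfSpaces γ then 0 else 1) fun A B h => by
      have : A ∈ halfSpaces γ ↔ B ∈ halfSpaces γ := ⟨h.symm.mem_halfSpaces, h.mem_halfSpaces⟩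
      simp only [this]
    simp only [if_neg hbad'] at k2
    have k3 : badNum γ (β * τ) ≤ badNum γ β := by
      refine Finset.sum_le_sum fun y _ => ?_
      by_cases hy : autCone γ (y, true) ∈ halfSpaces β
      · have : autCone γ (y, true) ∈ halfSpaces (β * τ) := by
          obtain ⟨x, hx⟩ := mem_halfSpaces_iff.1 hy
          have hxa : x ≠ a.1 := by
            rintro rfl
            exact hbad' (hx.symm.mem_halfSpaces (autCone_mem_halfSpaces _ _))
          exact mem_halfSpaces_iff.2 ⟨x, hx.trans (h2 x hxa).symm⟩
        rw [if_pos this]; exact Nat.zero_le _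
      · rw [if_neg hy]; split_ifs <;> omega
    unfold potential
    change badNum (β * τ) γ + 1 = badNum β γ + _ at k2
    split_ifs at k2 with h
    · omega
    · rcases hc with hc | hc
      · omega
      · exact absurd hc.2 h

/-- The arcs from `g` to `g * w` within `C` that cross `B`. -/
def arcsWithin (w : FreeGroup X) (C B : Set (FreeGroup X)) : Set (FreeGroup X) :=
  {g | g ∈ C ∧ g * w ∈ C ∧ ¬(g ∈ B ↔ g * w ∈ B)}

section
omit [DecidableEq X]

lemma arcsWithin_mono {w : FreeGroup X} {C C' : Set (FreeGroup X)} (h : C ⊆ C')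
    (B : Set (FreeGroup X)) : arcsWithin w C B ⊆ arcsWithin w C' B :=
  fun _ hg => ⟨h hg.1, h hg.2.1, hg.2.2⟩

lemma arcsWithin_subset (w : FreeGroup X) (C B : Set (FreeGroup X)) :
    arcsWithin w C B ⊆ crossing w B := fun _ hg => hg.2.2

lemma arcsWithin_compl (w : FreeGroup X) (C B : Set (FreeGroup X)) :
    arcsWithin w C Bᶜ = arcsWithin w C B := by
  ext g; simp only [arcsWithin, Set.mem_ofPred_eq, Set.mem_compl_iff]; tauto

lemma weight_inter_le {w : FreeGroup X} {C B : Set (FreeGroup X)} (hC : (crossing w C).Finite)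
    (hB : (crossing w B).Finite)
    (h : (arcsWithin w C B).ncard ≤ (arcsWithin w Bᶜ C).ncard) :
    weight w (C ∩ B) ≤ weight w C := by
  have h1 : crossing w (C ∩ B) ⊆ arcsWithin w C B ∪ (crossing w C \ arcsWithin w Bᶜ C) := by
    intro g
    simp only [crossing, arcsWithin, Set.mem_union, Set.mem_sdiff, Set.mem_ofPred_eq,
      Set.mem_inter_iff, Set.mem_compl_iff]
    tauto
  have h2 := Set.ncard_le_ncard h1 ((hB.subset (arcsWithin_subset _ _ _)).union hC.sdiff)
  have h3 := Set.ncard_union_le (arcsWithin w C B) (crossing w C \ arcsWithin w Bᶜ C)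
  have h4 := Set.ncard_sdiff_add_ncard_of_subset (arcsWithin_subset w Bᶜ C) hC
  unfold weight
  omega

end

lemma letter_mem_autCone (β : MulAut (FreeGroup X)) (a : X × Bool) :
    β (letter a) ∈ autCone β a := by
  simp [autCone, letter_mem_cone]

lemma one_notMem_autCone (β : MulAut (FreeGroup X)) (a : X × Bool) : 1 ∉ autCone β a := by
  simp [autCone, one_notMem_cone]

lemma disjoint_autCone (β : MulAut (FreeGroup X)) {a d : X × Bool} (h : d ≠ a) :
    Disjoint (autCone β d) (autCone β a) :=
  Set.disjoint_left.2 fun _ h1 h2 => h (cone_unique h1 h2)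

lemma exists_compl_eq {β : MulAut (FreeGroup X)} {C : Set (FreeGroup X)} (hC : C ∈ halfSpaces β) :
    ∃ (v : FreeGroup X) (a : X × Bool), Cᶜ = v • autCone β a := by
  obtain ⟨v, a, h⟩ := compl_mem_halfSpaces hC
  exact ⟨v, a, h⟩

lemma finite_halfSpaces_cross [Finite X] {β : MulAut (FreeGroup X)} {B : Set (FreeGroup X)}
    (hB : ∀ u, (crossing u B).Finite) : {C | C ∈ halfSpaces β ∧ Cross C B}.Finite := by
  have : (⋃ a : X × Bool, (fun g => g • autCone β a) ''
      {g : FreeGroup X | Cross B (g • autCone β a)}).Finite :=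
    Set.finite_iUnion fun a => (finite_setOf_cross hB (autCone_mem_halfSpaces β a)).image _
  refine this.subset ?_
  rintro C ⟨⟨g, a, rfl⟩, hC⟩
  exact Set.mem_iUnion.2 ⟨a, g, hC.symm, rfl⟩

lemma totalCross_inter_lt [Fintype X] {γ : MulAut (FreeGroup X)} {C B : Set (FreeGroup X)}
    (hC : ∀ u, (crossing u C).Finite) (hB : B ∈ halfSpaces γ) (hCB : Cross C B) :
    totalCross γ (C ∩ B) < totalCross γ C := by
  have hsub : ∀ y : X, {g : FreeGroup X | Cross (C ∩ B) (g • autCone γ (y, true))} ⊆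
      {g : FreeGroup X | Cross C (g • autCone γ (y, true))} := by
    intro y g hg
    by_contra h
    exact hCB.not_cross_inter (fun h' => h h'.symm)
      (not_cross_of_mem_halfSpaces (smul_mem_halfSpaces (autCone_mem_halfSpaces _ _) g) hB)
      (Cross.symm hg)
  have hfin := fun y : X => finite_setOf_cross hC (autCone_mem_halfSpaces γ (y, true))
  refine Finset.sum_lt_sum (fun y _ => Set.ncard_le_ncard (hsub y) (hfin y)) ?_
  obtain ⟨y, hy⟩ := mem_halfSpaces_iff.1 hB
  refine ⟨y, Finset.mem_univ _, Set.ncard_lt_ncard ((Set.ssubset_iff_exists).2 ⟨hsub y, ?_⟩)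
    (hfin y)⟩
  have hn : ¬ Cross (C ∩ B) B := fun h => by
    obtain ⟨p, hp, hp'⟩ := h.2.1
    exact hp' hp.2
  obtain ⟨k, rfl | rfl⟩ := hy
  · exact ⟨k, hCB, hn⟩
  · rw [Set.smul_set_compl] at *
    rw [cross_compl_right] at hn hCB
    exact ⟨k, hCB, hn⟩

lemma canStep_of_minimal_cross [Fintype X] {w : FreeGroup X} {β γ : MulAut (FreeGroup X)}
    {C₀ B : Set (FreeGroup X)} (hC₀ : C₀ ∈ halfSpaces β) (hB : B ∈ halfSpaces γ)
    (hCB₀ : Cross C₀ B)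
    (hmin : ∀ C ∈ halfSpaces β, ∀ B' ∈ halfSpaces γ, Cross C B' →
      (arcsWithin w C₀ B).ncard ≤ (arcsWithin w B' C).ncard) : CanStep w β γ := by
  have hBf := crossing_finite_of_mem_halfSpaces hB
  obtain ⟨C, hCC₀, hC⟩ := (finite_halfSpaces_cross (β := β) hBf).exists_le_minimal ⟨hC₀, hCB₀⟩
  obtain ⟨⟨hCβ, hCB⟩, hCmin⟩ := hC
  have hCC₀' : (arcsWithin w C B).ncard ≤ (arcsWithin w C₀ B).ncard :=
    Set.ncard_le_ncard (arcsWithin_mono hCC₀ B) ((hBf w).subset (arcsWithin_subset _ _ _))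
  replace hmin : ∀ C' ∈ halfSpaces β, ∀ B' ∈ halfSpaces γ, Cross C' B' →
      (arcsWithin w C B).ncard ≤ (arcsWithin w B' C').ncard :=
    fun C' h1 B' h2 h3 => hCC₀'.trans (hmin C' h1 B' h2 h3)
  clear hCC₀' hCC₀ hCB₀ hC₀
  obtain ⟨v, a, hva⟩ := exists_compl_eq hCβ
  have hsub : ∀ d, d ≠ a → v • autCone β d ⊆ C := by
    intro d hd
    rw [← Set.disjoint_compl_right_iff_subset, hva, Set.disjoint_smul_set]
    exact disjoint_autCone β hd
  have hnest : ∀ d, d ≠ a → v • autCone β d ⊆ B ∨ v • autCone β d ⊆ Bᶜ := by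
    intro d hd
    by_cases hx : Cross (v • autCone β d) B
    · exfalso
      have hle := hCmin ⟨smul_mem_halfSpaces (autCone_mem_halfSpaces β d) v, hx⟩ (hsub d hd)
      have h1 : v ∉ v • autCone β d := by
        simpa [Set.mem_smul_set_iff_inv_smul_mem] using one_notMem_autCone β d
      have h2 : v ∉ Cᶜ := by
        simpa [hva, Set.mem_smul_set_iff_inv_smul_mem] using one_notMem_autCone β a
      exact h1 (hle (by simpa using h2))
    · rcases not_cross_iff.1 hx with h | h | h | h
      · exact Or.inr h
      · exact Or.inl h
      · obtain ⟨p, hp1, hp2⟩ := hCB.2.2.1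
        exact absurd (hsub d hd (h hp2)) hp1
      · obtain ⟨p, hp1, hp2⟩ := hCB.2.2.2
        exact absurd (hsub d hd (h hp2)) hp1
  have hCf := crossing_finite_of_mem_halfSpaces hCβ
  have hbad : C ∉ halfSpaces γ := fun h => not_cross_of_mem_halfSpaces h hB hCB
  clear hCmin
  wlog hfa : v • autCone β (flip a) ⊆ B generalizing B
  · refine this (compl_mem_halfSpaces hB) (crossing_finite_of_mem_halfSpaces
      (compl_mem_halfSpaces hB)) (cross_compl_right.2 hCB) ?_ ?_
      ((hnest _ (flip_ne a)).resolve_left hfa)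
    · simpa only [arcsWithin_compl] using hmin
    · intro d hd
      rw [compl_compl]
      exact (hnest d hd).symm
  have hCa : CutEquiv C (autCone β a) := (CutEquiv.compl C).symm.trans (hva ▸ CutEquiv.smul _ _)
  have hZ : CutEquiv (v⁻¹ • (C ∩ B)) (C ∩ B) := CutEquiv.smul _ _
  have hmemZ : ∀ d, d ≠ a → v • autCone β d ⊆ B → autCone β d ⊆ v⁻¹ • (C ∩ B) := by
    intro d hd h
    rw [← Set.smul_set_subset_smul_set_iff (a := v), smul_inv_smul]
    exact Set.subset_inter (hsub d hd) h
  have hdisj : Disjoint (autCone β a) (v⁻¹ • (C ∩ B)) := by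
    rw [← Set.disjoint_smul_set (a := v), smul_inv_smul, ← hva]
    exact Set.disjoint_left.2 fun x h1 h2 => h1 h2.1
  refine canStep_of_star (Z := v⁻¹ • (C ∩ B)) (a := a) ?_ ?_ ?_ ?_ (Or.inl ?_)
  · intro d
    by_cases hd : d = a
    · rw [hd]; exact Or.inr hdisj
    · rcases hnest d hd with h | h
      · exact Or.inl (hmemZ d hd h)
      · right
        rw [← Set.disjoint_smul_set (a := v), smul_inv_smul]
        exact Set.disjoint_left.2 fun x h1 h2 => h h1 h2.2
  · have h1 := hmemZ _ (flip_ne a) hfa (letter_mem_autCone β (flip a))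
    have h2 := Set.disjoint_left.1 hdisj (letter_mem_autCone β a)
    tauto
  · rw [hZ.weight_eq, ← hCa.weight_eq]
    exact weight_inter_le (hCf w) (hBf w) (hmin C hCβ Bᶜ (compl_mem_halfSpaces hB)
      (cross_compl_right.2 hCB))
  · exact fun h => hbad (hCa.mem_halfSpaces h)
  · rw [hZ.totalCross_eq, ← hCa.totalCross_eq]
    exact totalCross_inter_lt hCf hB hCB

/-- If some half-spaces of the two bases cross then one of the bases can be improved. -/
lemma canStep_of_cross [Fintype X] (w : FreeGroup X) {β γ : MulAut (FreeGroup X)}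
    {C B : Set (FreeGroup X)} (hC : C ∈ halfSpaces β) (hB : B ∈ halfSpaces γ)
    (hCB : Cross C B) : CanStep w β γ ∨ CanStep w γ β := by
  classical
  let P : ℕ → Prop := fun n => ∃ C ∈ halfSpaces β, ∃ B ∈ halfSpaces γ, Cross C B ∧
    ((arcsWithin w C B).ncard = n ∨ (arcsWithin w B C).ncard = n)
  have hP : ∃ n, P n := ⟨_, C, hC, B, hB, hCB, Or.inl rfl⟩
  obtain ⟨C', hC', B', hB', hCB', h⟩ := Nat.find_spec hP
  have hmin : ∀ C ∈ halfSpaces β, ∀ B ∈ halfSpaces γ, Cross C B →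
      Nat.find hP ≤ (arcsWithin w C B).ncard ∧ Nat.find hP ≤ (arcsWithin w B C).ncard :=
    fun C hC B hB hCB => ⟨Nat.find_le ⟨C, hC, B, hB, hCB, Or.inl rfl⟩,
      Nat.find_le ⟨C, hC, B, hB, hCB, Or.inr rfl⟩⟩
  rcases h with h | h
  · left
    refine canStep_of_minimal_cross hC' hB' hCB' fun C h1 B h2 h3 => ?_
    rw [h]; exact (hmin C h1 B h2 h3).2
  · right
    refine canStep_of_minimal_cross hB' hC' hCB'.symm fun B h1 C h2 h3 => ?_
    rw [h]; exact (hmin C h2 B h1 h3.symm).1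

section
omit [DecidableEq X]

lemma crossing_mul (u v : FreeGroup X) (S : Set (FreeGroup X)) :
    crossing (u * v) S = symmDiff (crossing u S) ((fun g => g * u⁻¹) '' crossing v S) := by
  ext g
  rw [Set.image_mul_right, inv_inv, Set.mem_symmDiff]
  simp only [crossing, Set.mem_ofPred_eq, Set.mem_preimage, mul_assoc]
  tauto

lemma ncard_symmDiff_cast {α : Type*} {s t : Set α} (hs : s.Finite) (ht : t.Finite) :
    ((symmDiff s t).ncard : ZMod 2) = s.ncard + t.ncard := by
  have h1 := Set.ncard_union_eq (s := s \ t) (t := t \ s)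
    (Set.disjoint_left.2 fun x h1 h2 => h2.2 h1.1) hs.sdiff ht.sdiff
  have h2 := Set.ncard_inter_add_ncard_sdiff_eq_ncard s t hs
  have h3 := Set.ncard_inter_add_ncard_sdiff_eq_ncard t s ht
  rw [Set.inter_comm] at h3
  have h4 : symmDiff s t = s \ t ∪ t \ s := rfl
  rw [h4, h1, ← h2, ← h3]
  push_cast
  have : ((s ∩ t).ncard : ZMod 2) + (s ∩ t).ncard = 0 := CharTwo.add_self_eq_zero _
  linear_combination -this

lemma weight_mul_cast {S : Set (FreeGroup X)} (hS : ∀ u, (crossing u S).Finite)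
    (u v : FreeGroup X) : (weight (u * v) S : ZMod 2) = weight u S + weight v S := by
  rw [weight, crossing_mul, ncard_symmDiff_cast (hS u) ((hS v).image _),
    Set.ncard_image_of_injective _ (mul_left_injective u⁻¹)]
  rfl

lemma eq_zero_of_additive {f : FreeGroup X → ZMod 2} (hf : ∀ u v, f (u * v) = f u + f v)
    (β : MulAut (FreeGroup X)) (h : ∀ x, f (β (of x)) = 0) (u : FreeGroup X) : f u = 0 := by
  have h1 : f 1 = 0 := by simpa using hf 1 1
  have hinv : ∀ u, f u⁻¹ = f u := by
    intro u
    have := hf u u⁻¹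
    rw [mul_inv_cancel, h1] at this
    rw [← CharTwo.add_eq_zero, add_comm, ← this]
  obtain ⟨u, rfl⟩ := β.surjective u
  induction u using FreeGroup.induction_on with
  | C1 => simpa using h1
  | of x => exact h x
  | inv_of x _ => rw [_root_.map_inv, hinv]; exact h x
  | mul u v hu hv => rw [_root_.map_mul, hf, hu, hv, add_zero]

end

lemma weight_autCone_of (β : MulAut (FreeGroup X)) (x z : X) :
    weight (β (of z)) (autCone β (x, true)) = if z = x then 1 else 0 := by
  have hz : of z = letter (z, true) := rfl
  rw [weight, crossing_autCone, Set.ncard_image_of_injective _ β.injective, MulAut.inv_apply_self,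
    hz, crossing_letter_cone]
  have : flip (z, true) ≠ (x, true) := by simp [flip]
  by_cases h : z = x
  · subst h
    simp [this]
  · simp [this, h]

lemma even_weight_of_star {β : MulAut (FreeGroup X)} {Z : Set (FreeGroup X)} (hZ : IsStarFor β Z)
    {c : X × Bool} (h : β (letter c) ∈ Z ↔ β (letter (flip c)) ∈ Z) :
    (weight (β (letter c)) Z : ZMod 2) = 0 := by
  wlog h1 : 1 ∉ Z generalizing Z
  · rw [weight, ← crossing_compl]
    exact this hZ.compl (not_congr h) (by simpa using h1)
  have h1Y : (1 : FreeGroup X) ∉ β ⁻¹' Z := by simpa using h1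
  have hcr : crossing (β (letter c)) Z = β '' crossing (letter c) (β ⁻¹' Z) := by
    ext g
    constructor
    · intro hg; exact ⟨β⁻¹ g, by simpa [crossing] using hg, by simp⟩
    · rintro ⟨k, hk, rfl⟩; simpa [crossing] using hk
  have hne : letter (flip c) ≠ 1 := by
    intro h
    have := congrArg toWord h
    rw [toWord_letter] at this
    simp at this
  have hd := hZ.isStar.ind_mul_letter h1Y
  rw [weight, hcr, Set.ncard_image_of_injective _ β.injective]
  have hsame : ind (β ⁻¹' Z) (letter c) = ind (β ⁻¹' Z) (letter (flip c)) := by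
    rw [ind_eq_iff]; exact h
  by_cases hc : β (letter c) ∈ Z
  · have hi : ind (β ⁻¹' Z) (letter c) = 1 := by simp [ind, hc]
    have : crossing (letter c) (β ⁻¹' Z) = {1, letter (flip c)} := by
      ext g
      change ¬ (_ ↔ _) ↔ _
      rw [← ind_eq_iff, hd, ← hsame, hi, Set.mem_insert_iff, Set.mem_singleton_iff]
      clear hsame hd
      generalize letter (flip c) = l at hne
      by_cases e1 : g = 1
      · subst e1; simp [hne.symm]
      · by_cases e2 : g = l
        · simp [e2, hne]; omega
        · simp [e1, e2]
    rw [this, Set.ncard_pair hne.symm]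
    rfl
  · have hi : ind (β ⁻¹' Z) (letter c) = 0 := by simp [ind, hc]
    have : crossing (letter c) (β ⁻¹' Z) = ∅ := by
      ext g
      change ¬ (_ ↔ _) ↔ _
      rw [← ind_eq_iff, hd, ← hsame, hi]
      simp
    rw [this]; simp

/-- The exchange property: some element of `β(X)` is separated by `Z` and can be replaced. -/
lemma exists_exchange [Fintype X] {β : MulAut (FreeGroup X)} {Z : Set (FreeGroup X)}
    (hZ : ∀ u, (crossing u Z).Finite) {u : FreeGroup X} (hu : (weight u Z : ZMod 2) ≠ 0) :
    ∃ x, (weight (β (of x)) Z : ZMod 2) ≠ 0 ∧ weight u (autCone β (x, true)) ≠ 0 := by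
  by_contra! hno
  have := eq_zero_of_additive (β := β) (f := fun u => (weight u Z : ZMod 2) -
    ∑ x, (weight (β (of x)) Z : ZMod 2) * weight u (autCone β (x, true))) ?_ ?_ u
  · refine hu ?_
    rw [Finset.sum_eq_zero, sub_zero] at this
    · exact this
    · intro x _
      by_cases hx : (weight (β (of x)) Z : ZMod 2) = 0
      · rw [hx, zero_mul]
      · rw [hno x hx, Nat.cast_zero, mul_zero]
  · intro u v
    rw [weight_mul_cast hZ]
    simp_rw [weight_mul_cast
      (crossing_finite_of_mem_halfSpaces (autCone_mem_halfSpaces β _)), mul_add]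
    rw [Finset.sum_add_distrib]
    ring
  · intro z
    simp [weight_autCone_of]

omit [DecidableEq X] in
lemma exists_boundary_edge {B : Set (FreeGroup X)} (β : MulAut (FreeGroup X)) (h1 : B.Nonempty)
    (h2 : Bᶜ.Nonempty) : ∃ g c, g ∈ B ∧ g * β (letter c) ∉ B := by
  by_contra! hno
  have hf := eq_of_forall_mul_letter (f := ind (β ⁻¹' B)) fun g c => by
    rw [ind_eq_iff]
    constructor
    · intro h
      have := hno _ (flip c) h
      rw [← _root_.map_mul, letter_flip, mul_inv_cancel_right] at this
      exact this
    · intro h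
      have := hno _ c h
      rwa [← _root_.map_mul] at this
  obtain ⟨p, hp⟩ := h1
  obtain ⟨q, hq⟩ := h2
  have := (hf (β⁻¹ p)).trans (hf (β⁻¹ q)).symm
  rw [ind_eq_iff] at this
  exact hq (by simpa using this.1 (by simpa using hp))

lemma isStarFor_of_edge {β : MulAut (FreeGroup X)} {B : Set (FreeGroup X)} {g : FreeGroup X}
    {c : X × Bool} (hn : ∀ A ∈ halfSpaces β, ¬ Cross A B) (hg : g ∈ B)
    (hgc : g * β (letter c) ∉ B) (hA : g • autCone β c ⊆ Bᶜ) : IsStarFor β (g⁻¹ • B) := by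
  have hiff : ∀ d, (g • autCone β d ⊆ B ∨ g • autCone β d ⊆ Bᶜ) →
      (autCone β d ⊆ g⁻¹ • B ∨ Disjoint (autCone β d) (g⁻¹ • B)) := by
    rintro d (h | h)
    · left; rwa [← Set.smul_set_subset_smul_set_iff (a := g), smul_inv_smul]
    · right
      rw [← Set.disjoint_smul_set (a := g), smul_inv_smul]
      exact Set.disjoint_left.2 fun x h1 h2 => h h1 h2
  intro d
  refine hiff d ?_
  by_cases hd : d = c
  · rw [hd]; exact Or.inr hA
  · have h1 : g ∉ g • autCone β d := by
      simpa [Set.mem_smul_set_iff_inv_smul_mem] using one_notMem_autCone β d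
    have h2 : g * β (letter c) ∉ g • autCone β d := by
      rw [Set.mem_smul_set_iff_inv_smul_mem, smul_eq_mul, inv_mul_cancel_left]
      exact Set.disjoint_right.1 (disjoint_autCone β hd) (letter_mem_autCone β c)
    rcases not_cross_iff.1 (hn _ (smul_mem_halfSpaces (autCone_mem_halfSpaces β d) g)) with
      h | h | h | h
    · exact Or.inr h
    · exact Or.inl h
    · exact absurd (h hg) h1
    · exact absurd (h hgc) h2

lemma exists_isStarFor {β : MulAut (FreeGroup X)} {B : Set (FreeGroup X)}
    (hn : ∀ A ∈ halfSpaces β, ¬ Cross A B) (h1 : B.Nonempty) (h2 : Bᶜ.Nonempty) :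
    ∃ g : FreeGroup X, IsStarFor β (g • B) := by
  obtain ⟨g, c, hg, hgc⟩ := exists_boundary_edge β h1 h2
  have e1 : g ∉ g • autCone β c := by
    simpa [Set.mem_smul_set_iff_inv_smul_mem] using one_notMem_autCone β c
  have e2 : g * β (letter c) ∈ g • autCone β c := by
    rw [Set.mem_smul_set_iff_inv_smul_mem, smul_eq_mul, inv_mul_cancel_left]
    exact letter_mem_autCone β c
  rcases not_cross_iff.1 (hn _ (smul_mem_halfSpaces (autCone_mem_halfSpaces β c) g)) with
    h | h | h | h
  · exact ⟨g⁻¹, isStarFor_of_edge hn hg hgc h⟩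
  · exact absurd (h e2) hgc
  · exact absurd (h hg) e1
  · have hA : (g * β (letter c)) • autCone β (flip c) ⊆ Bᶜᶜ := by
      rw [mul_smul, ← autCone_compl, Set.smul_set_compl]
      exact Set.compl_subset_compl.2 h
    have := isStarFor_of_edge (c := flip c) (fun A hA => by
      rw [cross_compl_right]; exact hn A hA) (B := Bᶜ) hgc
      (by rw [letter_flip, _root_.map_inv, mul_inv_cancel_right]; exact fun h => h hg) hA
    refine ⟨(g * β (letter c))⁻¹, ?_⟩
    simpa [Set.smul_set_compl] using this.compl

lemma canStep_of_bad [Fintype X] {w : FreeGroup X} {β γ : MulAut (FreeGroup X)}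
    (hn : ∀ A ∈ halfSpaces β, ∀ B ∈ halfSpaces γ, ¬ Cross A B) {y : X}
    (hy : autCone γ (y, true) ∉ halfSpaces β)
    (hmin : ∀ x, autCone β (x, true) ∉ halfSpaces γ →
      weight w (autCone γ (y, true)) ≤ weight w (autCone β (x, true))) : CanStep w β γ := by
  have hyγ := autCone_mem_halfSpaces γ (y, true)
  obtain ⟨g, hg⟩ := exists_isStarFor (fun A hA => hn A hA _ hyγ)
    ⟨_, letter_mem_autCone γ _⟩ ⟨_, one_notMem_autCone γ _⟩
  have hZ : CutEquiv (g • autCone γ (y, true)) (autCone γ (y, true)) := CutEquiv.smul _ _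
  have hZγ := hZ.mem_halfSpaces hyγ
  obtain ⟨x, hx1, hx2⟩ := exists_exchange (β := β) (u := γ (of y))
    (crossing_finite_of_mem_halfSpaces hZγ) (by
      rw [hZ.weight_eq, weight_autCone_of, if_pos rfl]; decide)
  have hxbad : autCone β (x, true) ∉ halfSpaces γ := by
    intro h
    obtain ⟨z, hz⟩ := mem_halfSpaces_iff.1 h
    rw [hz.weight_eq, weight_autCone_of] at hx2
    have : y = z := by by_contra hne; exact hx2 (if_neg hne)
    subst this
    exact hy (hz.symm.mem_halfSpaces (autCone_mem_halfSpaces _ _))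
  refine canStep_of_star hg (a := (x, true)) ?_ ?_ hxbad (Or.inr ⟨?_, hZγ⟩)
  · by_contra hne
    refine hx1 (even_weight_of_star hg (c := (x, true)) ?_)
    tauto
  · rw [hZ.weight_eq]; exact hmin x hxbad
  · have : totalCross γ (g • autCone γ (y, true)) = 0 := by
      refine Finset.sum_eq_zero fun z _ => ?_
      have : {k : FreeGroup X | Cross (g • autCone γ (y, true)) (k • autCone γ (z, true))} = ∅ :=
        Set.eq_empty_of_forall_notMem fun k hk => not_cross_of_mem_halfSpaces hZγ
          (smul_mem_halfSpaces (autCone_mem_halfSpaces _ _) k) hk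
      rw [crossNum, this, Set.ncard_empty]
    rw [this]; exact Nat.zero_le _

lemma norm_eq_of_halfSpaces [Fintype X] {β γ : MulAut (FreeGroup X)}
    (h : ∀ x, autCone β (x, true) ∈ halfSpaces γ) (u : FreeGroup X) :
    (β⁻¹ u).norm = (γ⁻¹ u).norm := by
  choose y hy using fun x => mem_halfSpaces_iff.1 (h x)
  have hinj : Function.Injective y := by
    intro x x' hxx
    have h1 := (hy x).trans (hxx ▸ (hy x').symm)
    have h2 := h1.weight_eq (β (of x))
    rw [weight_autCone_of, weight_autCone_of, if_pos rfl] at h2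
    by_contra hne
    rw [if_neg hne] at h2
    exact one_ne_zero h2
  rw [← sum_weight_autCone, ← sum_weight_autCone]
  rw [← (Finite.injective_iff_bijective.1 hinj).sum_comp
    fun y => weight u (autCone γ (y, true))]
  exact Finset.sum_congr rfl fun x _ => (hy x).weight_eq u

/-- Either one of two bases can be moved closer to the other, or they define the same metric. -/
lemma canStep_or_norm_eq [Fintype X] (w : FreeGroup X) (β γ : MulAut (FreeGroup X)) :
    CanStep w β γ ∨ CanStep w γ β ∨ ∀ u, (β⁻¹ u).norm = (γ⁻¹ u).norm := by
  classical
  by_cases hn : ∀ A ∈ halfSpaces β, ∀ B ∈ halfSpaces γ, ¬ Cross A B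
  swap
  · push Not at hn
    obtain ⟨A, hA, B, hB, h⟩ := hn
    rcases canStep_of_cross w hA hB h with h | h
    · exact Or.inl h
    · exact Or.inr (Or.inl h)
  by_cases hgood : ∀ x, autCone β (x, true) ∈ halfSpaces γ
  · exact Or.inr (Or.inr (norm_eq_of_halfSpaces hgood))
  push Not at hgood
  obtain ⟨x, hx⟩ := hgood
  let P : ℕ → Prop := fun n =>
    (∃ x, autCone β (x, true) ∉ halfSpaces γ ∧ weight w (autCone β (x, true)) = n) ∨
    ∃ y, autCone γ (y, true) ∉ halfSpaces β ∧ weight w (autCone γ (y, true)) = n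
  have hP : ∃ n, P n := ⟨_, Or.inl ⟨x, hx, rfl⟩⟩
  rcases Nat.find_spec hP with ⟨x, hx, h⟩ | ⟨y, hy, h⟩
  · refine Or.inr (Or.inl (canStep_of_bad (fun A hA B hB hc => hn B hB A hA hc.symm) hx
      fun y hy => ?_))
    rw [h]; exact Nat.find_min' hP (Or.inr ⟨y, hy, rfl⟩)
  · refine Or.inl (canStep_of_bad hn hy fun x hx => ?_)
    rw [h]; exact Nat.find_min' hP (Or.inl ⟨x, hx, rfl⟩)

lemma cyclicLength_le_norm_conj (g w : FreeGroup X) :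
    cyclicLength w ≤ (g * w * g⁻¹).norm := Nat.sInf_le ⟨g, rfl⟩

lemma cyclicLength_conj (g w : FreeGroup X) : cyclicLength (g * w * g⁻¹) = cyclicLength w := by
  unfold cyclicLength
  congr 1
  ext n
  constructor
  · rintro ⟨k, rfl⟩
    exact ⟨k * g, by simp [mul_assoc]⟩
  · rintro ⟨k, rfl⟩
    exact ⟨k * g⁻¹, by simp [mul_assoc]⟩

lemma cyclicLength_le_norm (w : FreeGroup X) : cyclicLength w ≤ w.norm := by
  simpa using cyclicLength_le_norm_conj 1 w

section
omit [DecidableEq X]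

lemma _root_.IsInnerAut.mul {σ τ : MulAut (FreeGroup X)} (h : IsInnerAut σ) (h' : IsInnerAut τ) :
    IsInnerAut (σ * τ) := by
  obtain ⟨g, rfl⟩ := h
  obtain ⟨g', rfl⟩ := h'
  exact ⟨g * g', by rw [_root_.map_mul]⟩

lemma _root_.IsInnerAut.inv {σ : MulAut (FreeGroup X)} (h : IsInnerAut σ) : IsInnerAut σ⁻¹ := by
  obtain ⟨g, rfl⟩ := h
  exact ⟨g⁻¹, by rw [_root_.map_inv]⟩

lemma inv_mem_Xpm {g : FreeGroup X} (h : g ∈ Xpm X) : g⁻¹ ∈ Xpm X := by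
  obtain ⟨c, rfl⟩ := mem_Xpm_iff.1 h
  exact mem_Xpm_iff.2 ⟨flip c, by rw [letter_flip]⟩

lemma _root_.IsTypeII.inv {τ : MulAut (FreeGroup X)} (h : IsTypeII τ) : IsTypeII τ⁻¹ := by
  obtain ⟨a, ha, haa, hx⟩ := h
  have ha' : τ⁻¹ a = a := by
    conv_lhs => rw [← haa]
    simp
  refine ⟨a⁻¹, inv_mem_Xpm ha, by rw [_root_.map_inv, ha'], fun x hxX => ?_⟩
  have key : ∀ y, τ x = y → τ⁻¹ y = x := by rintro y rfl; simp
  rcases hx x hxX with h | h | h | h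
  · exact Or.inl (key _ h)
  · have := key _ h
    rw [_root_.map_mul, ha', ← eq_mul_inv_iff_mul_eq] at this
    exact Or.inr (Or.inl this)
  · have := key _ h
    rw [_root_.map_mul, _root_.map_inv, ha', inv_mul_eq_iff_eq_mul] at this
    exact Or.inr (Or.inr (Or.inl (by rw [this, inv_inv])))
  · have := key _ h
    rw [_root_.map_mul, _root_.map_mul, _root_.map_inv, ha', ← eq_mul_inv_iff_mul_eq,
      inv_mul_eq_iff_eq_mul] at this
    exact Or.inr (Or.inr (Or.inr (by rw [this, inv_inv, mul_assoc])))

end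

lemma norm_eq_one_iff_mem_Xpm {g : FreeGroup X} : g.norm = 1 ↔ g ∈ Xpm X := by
  rw [mem_Xpm_iff]
  constructor
  · intro h
    obtain ⟨c, hc⟩ := List.length_eq_one_iff.1 h
    exact ⟨c, by rw [letter, ← hc, mk_toWord]⟩
  · rintro ⟨c, rfl⟩
    rw [FreeGroup.norm, toWord_letter]; rfl

/-- Automorphisms preserving the word length. -/
def IsIsometry (σ : MulAut (FreeGroup X)) : Prop := ∀ g, (σ g).norm = g.norm

lemma IsIsometry.inv {σ : MulAut (FreeGroup X)} (h : IsIsometry σ) : IsIsometry σ⁻¹ := by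
  intro g
  rw [← h (σ⁻¹ g), MulAut.apply_inv_self]

lemma IsIsometry.map_mem_Xpm {σ : MulAut (FreeGroup X)} (h : IsIsometry σ) {g : FreeGroup X}
    (hg : g ∈ Xpm X) : σ g ∈ Xpm X := by
  rw [← norm_eq_one_iff_mem_Xpm, h, norm_eq_one_iff_mem_Xpm]; exact hg

lemma IsIsometry.isTypeI {σ : MulAut (FreeGroup X)} (h : IsIsometry σ) : IsTypeI σ := by
  refine ⟨σ, ⟨fun g hg => h.map_mem_Xpm hg, σ.injective.injOn, fun g hg => ?_⟩,
    fun x _ => _root_.map_inv σ x, fun x => rfl⟩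
  exact ⟨σ⁻¹ g, h.inv.map_mem_Xpm hg, by simp⟩

lemma IsIsometry.isTypeII_conj {σ τ : MulAut (FreeGroup X)} (h : IsIsometry σ)
    (hτ : IsTypeII τ) : IsTypeII (σ * τ * σ⁻¹) := by
  obtain ⟨a, ha, haa, hx⟩ := hτ
  refine ⟨σ a, h.map_mem_Xpm ha, by simp [haa], fun x hxX => ?_⟩
  have := hx _ (h.inv.map_mem_Xpm hxX)
  have e : ∀ y, τ (σ⁻¹ x) = y → (σ * τ * σ⁻¹) x = σ y := by rintro y rfl; rfl
  rcases this with h | h | h | h <;> rw [e _ h] <;> simp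

/-- The type II part of the definition of `TS`. -/
def IsStrictlyMinimal (w : FreeGroup X) : Prop :=
  ∀ τ : MulAut (FreeGroup X), IsTypeII τ → ¬ IsInnerAut τ → cyclicLength w < cyclicLength (τ w)

lemma exists_inner_mul_isometry [Fintype X] {w : FreeGroup X} (hw : IsStrictlyMinimal w)
    (β γ : MulAut (FreeGroup X)) (hβ : IsInnerAut β) (hβw : (β⁻¹ w).norm ≤ cyclicLength w)
    (hγw : (γ⁻¹ w).norm ≤ cyclicLength w) :
    ∃ δ σ : MulAut (FreeGroup X), IsInnerAut δ ∧ IsIsometry σ ∧ γ = δ * σ := by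
  induction hn : potential β γ using Nat.strong_induction_on generalizing β γ with
  | _ n ih =>
    subst hn
    rcases canStep_or_norm_eq w β γ with ⟨τ, hτ, h1, h2⟩ | ⟨τ, hτ, h1, h2⟩ | h
    · have hin : IsInnerAut τ := by
        by_contra hni
        have h3 := hw τ⁻¹ hτ.inv fun h => hni (by simpa using h.inv)
        obtain ⟨g, hg⟩ := hβ.inv
        have h4 : (β * τ)⁻¹ w = τ⁻¹ g * τ⁻¹ w * (τ⁻¹ g)⁻¹ := by
          rw [mul_inv_rev, MulAut.mul_apply, hg, MulAut.conj_apply]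
          simp only [_root_.map_mul, _root_.map_inv]
        have h5 := cyclicLength_le_norm ((β * τ)⁻¹ w)
        rw [h4, cyclicLength_conj, ← h4] at h5
        omega
      exact ih _ h2 (β * τ) γ (hβ.mul hin) (h1.trans hβw) hγw rfl
    · rw [potential_comm, potential_comm γ β] at h2
      obtain ⟨δ, σ, hδ, hσ, e⟩ := ih _ h2 β (γ * τ) hβ hβw (h1.trans hγw) rfl
      have e1 : γ = δ * (σ * τ⁻¹ * σ⁻¹) * σ := by
        rw [eq_mul_inv_of_mul_eq e]; group
      have hin : IsInnerAut (σ * τ * σ⁻¹) := by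
        by_contra hni
        have h3 := hw _ (hσ.isTypeII_conj hτ) hni
        obtain ⟨g, hg⟩ := hδ.inv
        have h4 : σ (γ⁻¹ w) = (σ * τ * σ⁻¹) g * (σ * τ * σ⁻¹) w * ((σ * τ * σ⁻¹) g)⁻¹ := by
          have : σ * γ⁻¹ = (σ * τ * σ⁻¹) * δ⁻¹ := by rw [e1]; group
          rw [← MulAut.mul_apply, this, MulAut.mul_apply, hg, MulAut.conj_apply, _root_.map_mul,
            _root_.map_mul, _root_.map_inv]
        have h5 := cyclicLength_le_norm (σ (γ⁻¹ w))
        rw [h4, cyclicLength_conj, ← h4, hσ] at h5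
        omega
      refine ⟨_, σ, hδ.mul ?_, hσ, e1⟩
      have := hin.inv
      simpa [mul_assoc] using this
    · refine ⟨β, β⁻¹ * γ, hβ, fun g => ?_, by group⟩
      rw [MulAut.mul_apply, h, MulAut.inv_apply_self]

end Whitehead

/-- if w ∈ TS and α ∈ Aut F(X) satisfies α(w) = w, then α is inner. -/
theorem statement14 (X : Type) [Fintype X] [DecidableEq X] (hX : 2 ≤ Fintype.card X)
    (w : FreeGroup X) (hw : w ∈ TS X)
    (α : MulAut (FreeGroup X)) (hα : α w = w) :
    IsInnerAut α := by
  obtain ⟨hcyc, -, hII, hI⟩ := hw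
  have hαw : α⁻¹ w = w := by
    conv_lhs => rw [← hα]
    exact MulAut.inv_apply_self _ _ _
  obtain ⟨δ, σ, hδ, hσ, rfl⟩ := Whitehead.exists_inner_mul_isometry hII 1 α ⟨1, by simp⟩
    hcyc.le (by rw [hαw]; exact hcyc.le)
  have h1 : σ = 1 := by
    by_contra hne
    refine hI σ hσ.isTypeI hne ?_
    obtain ⟨g, rfl⟩ := hδ
    exact (isConj_iff.2 ⟨g, hα⟩).symm
  rw [h1, mul_one]
  exact hδ
end

section
/- Let X be a finite set with #X ≥ 2. The set of elements w ∈ F(X) such that σ(w) is conjugate to w for some non-identity type I Whitehead automorphism σ is exponentially F(X)-negligible. -/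
namespace FreeGroup

variable {α : Type*}

/-- The formal inverse of a letter of a free group. -/
def letterInv (a : α × Bool) : α × Bool := (a.1, !a.2)

theorem letterInv_ne (a : α × Bool) : letterInv a ≠ a := by
  intro h
  simpa [letterInv] using congrArg Prod.snd h

theorem letterInv_letterInv (a : α × Bool) : letterInv (letterInv a) = a := by
  simp [letterInv]

theorem ne_letterInv_iff {a b : α × Bool} : b ≠ letterInv a ↔ (a.1 = b.1 → a.2 = b.2) := by
  obtain ⟨x, s⟩ := a
  obtain ⟨y, t⟩ := b
  cases s <;> cases t <;> simp [letterInv, eq_comm]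

theorem invRev_append_singleton (L : List (α × Bool)) (a : α × Bool) :
    invRev (L ++ [a]) = letterInv a :: invRev L := by
  simp [invRev, letterInv]

theorem invRev_cons_eq (L : List (α × Bool)) (a : α × Bool) :
    invRev (a :: L) = invRev L ++ [letterInv a] := by
  simp [invRev, letterInv]

theorem mk_letterInv (a : α × Bool) : mk [letterInv a] = (mk [a])⁻¹ := by
  simp [invRev, letterInv]

theorem IsReduced.invRev {L : List (α × Bool)} (h : IsReduced L) : IsReduced (invRev L) := by
  classical
  rw [isReduced_iff_reduce_eq] at h ⊢
  rw [reduce_invRev, h]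

theorem IsReduced.eq_of_mk_eq {L M : List (α × Bool)} (hL : IsReduced L) (hM : IsReduced M)
    (h : mk L = mk M) : L = M := by
  classical
  rw [← hL.reduce_eq, ← hM.reduce_eq]
  exact reduce.sound h

theorem IsCyclicallyReduced.append_singleton {L : List (α × Bool)} {a : α × Bool}
    (h : IsCyclicallyReduced (a :: L)) : IsCyclicallyReduced (L ++ [a]) := by
  obtain ⟨h₁, h₂⟩ := h
  cases L with
  | nil => simp
  | cons b L =>
    refine ⟨?_, ?_⟩
    · rw [IsReduced, List.isChain_append]
      refine ⟨h₁.infix ⟨[a], [], by simp⟩, by simp, ?_⟩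
      intro x hx y hy
      refine h₂ x ?_ y (by simpa using hy)
      simpa [List.getLast?_cons_cons] using hx
    · intro x hx y hy
      obtain rfl : a = x := by
        rw [List.getLast?_concat] at hx
        simpa using hx
      obtain rfl : b = y := by simpa using hy
      exact (isReduced_cons_cons.1 h₁).1

theorem IsCyclicallyReduced.cons_of_append_singleton {L : List (α × Bool)} {a : α × Bool}
    (h : IsCyclicallyReduced (L ++ [a])) : IsCyclicallyReduced (a :: L) := by
  obtain ⟨h₁, h₂⟩ := h
  cases L with
  | nil => simp
  | cons b L =>
    refine ⟨isReduced_cons_cons.2 ⟨h₂ a (List.getLast?_concat ..) b (by simp),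
      h₁.infix ⟨[], [a], by simp⟩⟩, ?_⟩
    intro x hx y hy
    rw [IsReduced, List.isChain_append] at h₁
    refine h₁.2.2 x ?_ y (by simpa using hy)
    simpa [List.getLast?_cons_cons] using hx

/-- Cyclically reduced words representing conjugate elements are cyclic permutations of each
other. -/
theorem IsCyclicallyReduced.isRotated_of_conj {V : List (α × Bool)} (hV : IsCyclicallyReduced V)
    (H : List (α × Bool)) (hH : IsReduced H) (U : List (α × Bool)) (hU : IsCyclicallyReduced U)
    (h : mk V = mk H * mk U * (mk H)⁻¹) : U ~r V := by
  induction H using List.reverseRecOn generalizing U with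
  | nil =>
    rw [← one_eq_mk, one_mul, inv_one, mul_one] at h
    rw [hV.1.eq_of_mk_eq hU.1 h]
  | append_singleton H c ih =>
    have hH' : IsReduced H := hH.infix ⟨[], [c], by simp⟩
    rw [← mul_mk] at h
    by_cases hU₀ : U = []
    · subst hU₀
      rw [← one_eq_mk, mul_one, mul_inv_cancel, one_eq_mk] at h
      rw [hV.1.eq_of_mk_eq .nil h]
    by_cases hhead : letterInv c ∈ U.head?
    · obtain ⟨U', rfl⟩ : ∃ U', U = letterInv c :: U' := by
        cases U with
        | nil => simp at hhead
        | cons u U' => exact ⟨U', by simpa using hhead⟩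
      refine List.IsRotated.trans ⟨1, by simp⟩ (ih hH' (U' ++ [letterInv c])
        hU.append_singleton ?_)
      rw [h, ← List.singleton_append (l := U'), ← mul_mk, ← mul_mk, mk_letterInv]
      group
    by_cases hlast : c ∈ U.getLast?
    · obtain ⟨U', rfl⟩ : ∃ U', U = U' ++ [c] := by
        induction U using List.reverseRecOn with
        | nil => simp at hlast
        | append_singleton U' u => exact ⟨U', by simpa using hlast⟩
      refine List.IsRotated.trans (List.IsRotated.symm ⟨1, by simp⟩)
        (ih hH' (c :: U') hU.cons_of_append_singleton ?_)
      rw [h, ← List.singleton_append (l := U'), ← mul_mk, ← mul_mk]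
      group
    exfalso
    have hHU : IsReduced (H ++ [c] ++ U) := by
      rw [IsReduced, List.isChain_append]
      refine ⟨hH, hU.1, fun x hx y hy => ?_⟩
      obtain rfl : c = x := by simpa using hx
      exact ne_letterInv_iff.1 fun hyc => hhead (hyc ▸ hy)
    have hUH : IsReduced (U ++ FreeGroup.invRev (H ++ [c])) := by
      rw [IsReduced, List.isChain_append]
      refine ⟨hU.1, hH.invRev, fun x hx y hy => ?_⟩
      rw [invRev_append_singleton] at hy
      obtain rfl : letterInv c = y := by simpa using hy
      refine ne_letterInv_iff.1 fun hyc => hlast ?_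
      rw [← letterInv_letterInv c, hyc, letterInv_letterInv]
      exact hx
    have hred : IsReduced (H ++ [c] ++ U ++ FreeGroup.invRev (H ++ [c])) :=
      IsReduced.append_overlap hHU hUH hU₀
    have hVeq : V = H ++ [c] ++ U ++ FreeGroup.invRev (H ++ [c]) := by
      refine hV.1.eq_of_mk_eq hred ?_
      rw [h, mul_mk, inv_mk, mul_mk, mul_mk]
    obtain ⟨d, K, hK⟩ : ∃ d K, H ++ [c] = d :: K := by
      cases H with
      | nil => exact ⟨c, [], rfl⟩
      | cons d K => exact ⟨d, K ++ [c], rfl⟩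
    rw [hVeq, hK, invRev_cons_eq] at hV
    have := hV.2 (letterInv d) 
      (by rw [← List.append_assoc]; exact List.getLast?_concat ..) d (by simp) rfl
    exact letterInv_ne d (Prod.ext rfl this)

theorem IsReduced.map_equiv {f : Equiv.Perm (α × Bool)}
    (hf : ∀ a, f (letterInv a) = letterInv (f a)) {L : List (α × Bool)} (h : IsReduced L) :
    IsReduced (L.map f) := by
  rw [IsReduced, List.isChain_map]
  refine List.IsChain.imp (fun a b hab => ?_) h
  rw [← ne_letterInv_iff] at hab ⊢
  rwa [← hf, f.injective.ne_iff]

theorem IsCyclicallyReduced.map_equiv {f : Equiv.Perm (α × Bool)}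
    (hf : ∀ a, f (letterInv a) = letterInv (f a)) {L : List (α × Bool)}
    (h : IsCyclicallyReduced L) : IsCyclicallyReduced (L.map f) := by
  refine ⟨h.1.map_equiv hf, ?_⟩
  intro a ha b hb
  simp only [List.getLast?_map, List.head?_map, Option.mem_def, Option.map_eq_some_iff] at ha hb
  obtain ⟨a, ha, rfl⟩ := ha
  obtain ⟨b, hb, rfl⟩ := hb
  have hab := h.2 a ha b hb
  rw [← ne_letterInv_iff] at hab ⊢
  rwa [← hf, f.injective.ne_iff]

end FreeGroup

theorem List.ncard_setOf_length_eq (β : Type*) [Fintype β] (n : ℕ) :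
    {L : List β | L.length = n}.ncard = Fintype.card β ^ n := by
  rw [← card_vector n, ← Nat.card_eq_fintype_card]
  rfl

theorem List.eq_of_map_eq_rotate {β : Type*} {f : β → β} {i : ℕ} (hi : 0 < i) {U V : List β}
    (hlen : U.length = V.length) (hU : U.map f = U.rotate i) (hV : V.map f = V.rotate i)
    (htake : U.take i = V.take i) : U = V := by
  have shift : ∀ (L : List β), L.map f = L.rotate i → ∀ j (hj : j + i < L.length),
      L[j + i] = f L[j] := by
    intro L hL j hj
    have h₁ : (L.map f)[j]'(by simp; omega) = (L.rotate i)[j]'(by simp; omega) := by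
      simp only [hL]
    rw [List.getElem_map, List.getElem_rotate] at h₁
    simp only [Nat.mod_eq_of_lt hj] at h₁
    exact h₁.symm
  refine List.ext_getElem hlen fun j hjU hjV => ?_
  induction j using Nat.strong_induction_on with
  | _ j ih =>
    by_cases hj : j < i
    · have h₁ : (U.take i)[j]'(by simp; omega) = (V.take i)[j]'(by simp; omega) := by
        simp only [htake]
      simpa using h₁
    · obtain ⟨l, rfl⟩ := Nat.exists_eq_add_of_le' (not_lt.1 hj)
      rw [shift U hU l hjU, shift V hV l hjV, ih l (by omega)]

namespace FreeGroup

variable {α : Type*}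

/-- Words of length `n` of the form `G U G⁻¹` with `G` of length `k` such that relabelling the
letters of `U` by `f` amounts to rotating `U` by `i` places, where `k + i ≤ n / 2`. -/
def twistedWords (f : Equiv.Perm (α × Bool)) (n k i : ℕ) : Set (List (α × Bool)) :=
  {W | W.length = n ∧ 2 * (k + i) ≤ n ∧ ∃ G U : List (α × Bool),
    G.length = k ∧ W = G ++ U ++ invRev G ∧ U.map f = U.rotate i}

theorem card_fixed_letters_le [Fintype α] [DecidableEq α] {f : Equiv.Perm (α × Bool)}
    (hf : ∀ a, f (letterInv a) = letterInv (f a)) (hf₁ : f ≠ 1) :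
    Fintype.card {a // f a = a} + 2 ≤ Fintype.card (α × Bool) := by
  obtain ⟨x, hx⟩ : ∃ x, f x ≠ x := by
    by_contra! h
    exact hf₁ (Equiv.ext h)
  have hx' : f (letterInv x) ≠ letterInv x := by
    rw [hf]
    intro h
    apply hx
    rw [← letterInv_letterInv (f x), h, letterInv_letterInv]
  have hdisj : Disjoint (Finset.univ.filter fun a => f a = a) {x, letterInv x} := by
    rw [Finset.disjoint_left]
    intro a ha hax
    simp only [Finset.mem_filter, Finset.mem_univ, true_and] at ha
    simp only [Finset.mem_insert, Finset.mem_singleton] at hax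
    rcases hax with rfl | rfl
    exacts [hx ha, hx' ha]
  rw [Fintype.card_subtype, ← Finset.card_pair (letterInv_ne x).symm,
    ← Finset.card_union_of_disjoint hdisj]
  exact Finset.card_le_univ _

theorem ncard_twistedWords_le [Fintype α] {f : Equiv.Perm (α × Bool)}
    (hf : ∀ a, f (letterInv a) = letterInv (f a)) (hf₁ : f ≠ 1) {q : ℕ} (hq : 2 ≤ q)
    (hcard : Fintype.card (α × Bool) = q + 2) (n k i : ℕ) :
    (twistedWords f n k i).ncard ≤ q ^ n := by
  classical
  have hqq : q + 2 ≤ q ^ 2 := by nlinarith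
  by_cases hki : 2 * (k + i) ≤ n
  swap
  · have : twistedWords f n k i = ∅ := by
      ext W
      simp [twistedWords, hki]
    simp [this]
  rcases Nat.eq_zero_or_pos i with rfl | hi
  · let φ : List (α × Bool) × List {a // f a = a} → List (α × Bool) :=
      fun p => p.1 ++ p.2.map Subtype.val ++ invRev p.1
    let S : Set (List (α × Bool) × List {a // f a = a}) :=
      {L | L.length = k} ×ˢ {L | L.length = n - 2 * k}
    have hS : S.Finite := (List.finite_length_eq _ k).prod (List.finite_length_eq _ _)
    have hsub : twistedWords f n k 0 ⊆ φ '' S := by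
      rintro W ⟨hW, -, G, U, hG, rfl, hU⟩
      rw [List.rotate_zero] at hU
      have hfix : ∀ a ∈ U, f a = a := by
        rw [← List.map_inj_left, hU, List.map_id']
      refine ⟨(G, U.attach.map fun a => ⟨a.1, hfix a.1 a.2⟩), ⟨hG, ?_⟩, ?_⟩
      · simp at hW ⊢
        omega
      · simp only [φ, List.map_map, Function.comp_def]
        rw [List.attach_map_subtype_val]
    have hfixed := card_fixed_letters_le hf hf₁
    calc (twistedWords f n k 0).ncard ≤ (φ '' S).ncard := Set.ncard_le_ncard hsub (hS.image _)
      _ ≤ S.ncard := Set.ncard_image_le hS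
      _ = (q + 2) ^ k * Fintype.card {a // f a = a} ^ (n - 2 * k) := by
        rw [Set.ncard_prod, List.ncard_setOf_length_eq, List.ncard_setOf_length_eq, hcard]
      _ ≤ (q ^ 2) ^ k * q ^ (n - 2 * k) := by
        gcongr
        omega
      _ = q ^ n := by
        rw [← pow_mul, ← pow_add]
        congr 1
        omega
  · have hinj : Set.InjOn (List.take (n / 2)) (twistedWords f n k i) := by
      rintro W ⟨hW, -, G, U, hG, rfl, hU⟩ W' ⟨hW', -, G', U', hG', rfl, hU'⟩ h
      simp only [List.length_append, invRev_length] at hW hW'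
      have h' := congrArg (List.take (k + i)) h
      simp only [List.take_take, Nat.min_eq_left (show k + i ≤ n / 2 by omega)] at h'
      have htake : ∀ G U : List (α × Bool), G.length = k → i ≤ U.length →
          (G ++ U ++ invRev G).take (k + i) = G ++ U.take i := by
        rintro G U rfl hiU
        rw [List.append_assoc, List.take_length_add_append, List.take_append_of_le_length hiU]
      rw [htake G U hG (by omega), htake G' U' hG' (by omega)] at h'
      obtain ⟨rfl, h₂⟩ := List.append_inj h' (by omega)
      rw [List.eq_of_map_eq_rotate hi (by omega) hU hU' h₂]
    calc (twistedWords f n k i).ncard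
        ≤ {L : List (α × Bool) | L.length = n / 2}.ncard := by
          refine Set.ncard_le_ncard_of_injOn _ ?_ hinj (List.finite_length_eq _ _)
          rintro W ⟨hW, -⟩
          simp only [Set.mem_ofPred_eq, List.length_take]
          omega
      _ = (q + 2) ^ (n / 2) := by rw [List.ncard_setOf_length_eq, hcard]
      _ ≤ (q ^ 2) ^ (n / 2) := by gcongr
      _ = q ^ (2 * (n / 2)) := by rw [← pow_mul]
      _ ≤ q ^ n := Nat.pow_le_pow_right (by omega) (by omega)

theorem exists_reduced_words [Fintype α] [DecidableEq α] {q : ℕ}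
    (hcard : Fintype.card (α × Bool) = q + 2) (n : ℕ) :
    ∃ S : Finset (List (α × Bool)), (∀ L ∈ S, IsReduced L ∧ L.length = n) ∧
      (q + 1) ^ n ≤ S.card := by
  classical
  induction n with
  | zero => exact ⟨{[]}, by simp, by simp⟩
  | succ n ih =>
    obtain ⟨S, hS, hSc⟩ := ih
    let T : List (α × Bool) → Finset (α × Bool) := fun L =>
      Finset.univ.filter fun c => IsReduced (c :: L)
    have hT : ∀ L ∈ S, q + 1 ≤ (T L).card := by
      intro L hL
      have hred := (hS L hL).1
      cases L with
      | nil => simp [T, hcard]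
      | cons b L =>
        have hsub : Finset.univ.erase (letterInv b) ⊆ T (b :: L) := by
          intro c hc
          simp only [Finset.mem_erase, Finset.mem_univ, and_true] at hc
          simp only [T, Finset.mem_filter, Finset.mem_univ, true_and]
          refine isReduced_cons_cons.2 ⟨fun h₁ => ?_, hred⟩
          exact (ne_letterInv_iff.1 hc h₁.symm).symm
        refine le_trans ?_ (Finset.card_le_card hsub)
        rw [Finset.card_erase_of_mem (Finset.mem_univ _), Finset.card_univ, hcard]
        rfl
    refine ⟨S.biUnion fun L => (T L).image fun c => c :: L, ?_, ?_⟩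
    · intro W hW
      simp only [Finset.mem_biUnion, Finset.mem_image, T, Finset.mem_filter] at hW
      obtain ⟨L, hL, c, hc, rfl⟩ := hW
      exact ⟨hc.2, by simp [(hS L hL).2]⟩
    · rw [Finset.card_biUnion]
      · calc (q + 1) ^ (n + 1) = (q + 1) ^ n * (q + 1) := pow_succ _ _
          _ ≤ S.card * (q + 1) := by gcongr
          _ ≤ ∑ L ∈ S, ((T L).image fun c => c :: L).card := by
            rw [← smul_eq_mul]
            refine Finset.card_nsmul_le_sum _ _ _ fun L hL => ?_
            rw [Finset.card_image_of_injective _ fun c d h => (List.cons.inj h).1]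
            exact hT L hL
      · intro L _ L' _ hne
        rw [Function.onFun, Finset.disjoint_left]
        intro W hW hW'
        simp only [Finset.mem_image] at hW hW'
        obtain ⟨c, -, rfl⟩ := hW
        obtain ⟨d, -, h⟩ := hW'
        exact hne (List.cons.inj h).2.symm

end FreeGroup

theorem exists_succ_pow_mul_pow_le (k : ℕ) {r : ℝ} (hr₀ : 0 < r) (hr₁ : r < 1) :
    ∃ C : ℝ, 0 < C ∧ ∃ s : ℝ, 0 < s ∧ s < 1 ∧ ∀ n : ℕ, ((n : ℝ) + 1) ^ k * r ^ n ≤ C * s ^ n := by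
  obtain ⟨s, hrs, hs₁⟩ := exists_between hr₁
  have hs₀ : 0 < s := hr₀.trans hrs
  have ht₀ : 0 < r / s := div_pos hr₀ hs₀
  have ht₁ : r / s < 1 := (div_lt_one hs₀).2 hrs
  obtain ⟨B, hB⟩ := (tendsto_pow_const_mul_const_pow_of_abs_lt_one k
    (abs_lt.2 ⟨by linarith, ht₁⟩)).bddAbove_range
  have hB' : ∀ n : ℕ, (n : ℝ) ^ k * (r / s) ^ n ≤ B := fun n => hB ⟨n, rfl⟩
  have hB₀ : 0 < B := by
    refine lt_of_lt_of_le ?_ (hB' 1)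
    simpa using ht₀
  refine ⟨B / (r / s), div_pos hB₀ ht₀, s, hs₀, hs₁, fun n => ?_⟩
  have h := hB' (n + 1)
  push_cast at h
  have h' : ((n : ℝ) + 1) ^ k * (r / s) ^ n ≤ B / (r / s) := by
    rw [le_div_iff₀ ht₀]
    simpa [pow_succ, mul_assoc] using h
  calc ((n : ℝ) + 1) ^ k * r ^ n = ((n : ℝ) + 1) ^ k * (r / s) ^ n * s ^ n := by
        rw [mul_assoc, ← mul_pow, div_mul_cancel₀ _ hs₀.ne']
    _ ≤ B / (r / s) * s ^ n := by gcongr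

open FreeGroup in
theorem IsTypeI.exists_perm {X : Type} {σ : MulAut (FreeGroup X)} (hσ : IsTypeI σ) :
    ∃ f : Equiv.Perm (X × Bool), (∀ a, f (letterInv a) = letterInv (f a)) ∧
      ∀ L, σ (mk L) = mk (L.map f) := by
  classical
  obtain ⟨π, hπ, hinv, hof⟩ := hσ
  have letter_inj : ∀ a b : X × Bool, mk [a] = mk [b] → a = b := fun a b h => by
    simpa using IsReduced.eq_of_mk_eq .singleton .singleton h
  have letter_true : ∀ x : X, mk [(x, true)] = of x := fun _ => rfl
  have letter_false : ∀ x : X, mk [(x, false)] = (of x)⁻¹ := fun _ => rfl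
  have letter_mem : ∀ a : X × Bool, mk [a] ∈ Xpm X := by
    rintro ⟨x, _ | _⟩
    · exact Or.inr ⟨x, rfl⟩
    · exact Or.inl ⟨x, rfl⟩
  have mem_letter : ∀ y ∈ Xpm X, ∃ a : X × Bool, mk [a] = y := by
    rintro y (⟨x, rfl⟩ | ⟨x, rfl⟩)
    · exact ⟨(x, true), rfl⟩
    · exact ⟨(x, false), rfl⟩
  choose f hf using fun a : X × Bool => mem_letter _ (hπ.mapsTo (letter_mem a))
  have hbij : Function.Bijective f := by
    constructor
    · intro a b hab
      refine letter_inj a b (hπ.injOn (letter_mem a) (letter_mem b) ?_)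
      rw [← hf, ← hf, hab]
    · intro b
      obtain ⟨y, hy, hyb⟩ := hπ.surjOn (letter_mem b)
      obtain ⟨a, rfl⟩ := mem_letter y hy
      exact ⟨a, letter_inj _ _ ((hf a).trans hyb)⟩
  have hfinv : ∀ a, f (letterInv a) = letterInv (f a) := fun a => by
    apply letter_inj
    rw [hf, mk_letterInv, mk_letterInv, hf, hinv _ (letter_mem a)]
  have hletter : ∀ a : X × Bool, σ (mk [a]) = mk [f a] := by
    rintro ⟨x, _ | _⟩
    · rw [hf, letter_false, _root_.map_inv, hof, hinv _ (Or.inl ⟨x, rfl⟩)]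
    · rw [hf, letter_true, hof]
  refine ⟨Equiv.ofBijective f hbij, hfinv, fun L => ?_⟩
  induction L with
  | nil => simp [← one_eq_mk]
  | cons a L ih =>
    rw [← List.singleton_append, ← mul_mk, _root_.map_mul, ih, hletter, mul_mk]
    rfl

open FreeGroup in
theorem IsTypeI.exists_mem_twistedWords {X : Type} [DecidableEq X]
    {σ : MulAut (FreeGroup X)} (hσ : IsTypeI σ) (hσ₁ : σ ≠ 1) {w : FreeGroup X}
    (hw : IsConj w (σ w)) :
    ∃ f : Equiv.Perm (X × Bool), ((∀ a, f (letterInv a) = letterInv (f a)) ∧ f ≠ 1) ∧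
      ∃ k ≤ w.norm, ∃ i ≤ w.norm, w.toWord ∈ twistedWords f w.norm k i := by
  obtain ⟨f, hf, hσf⟩ := hσ.exists_perm
  have hf₁ : f ≠ 1 := by
    rintro rfl
    refine hσ₁ (MulEquiv.ext fun v => ?_)
    rw [← mk_toWord (x := v), hσf]
    simp
  have hdecomp := reduceCyclically.conj_conjugator_reduceCyclically w.toWord
  have hU : IsCyclicallyReduced (reduceCyclically w.toWord) :=
    reduceCyclically.isCyclicallyReduced isReduced_toWord
  generalize reduceCyclically.conjugator w.toWord = G at hdecomp
  generalize reduceCyclically w.toWord = U at hdecomp hU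
  have hlen : G.length + U.length + G.length = w.norm := by
    simp [FreeGroup.norm, ← hdecomp, add_assoc]
  have hwU : IsConj (mk U) w := by
    rw [isConj_iff]
    refine ⟨mk G, ?_⟩
    rw [inv_mk, mul_mk, mul_mk, hdecomp, mk_toWord]
  have hconj : IsConj (mk U) (mk (U.map f)) := by
    rw [← hσf]
    exact (hwU.trans hw).trans (IsConj.symm (σ.toMonoidHom.map_isConj hwU))
  obtain ⟨c, hc⟩ := isConj_iff.1 hconj
  have hrot : U ~r U.map f := by
    refine (hU.map_equiv hf).isRotated_of_conj c.toWord isReduced_toWord U hU ?_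
    rw [mk_toWord, hc]
  obtain ⟨j, hj, hjU⟩ := List.isRotated_iff_mod.1 hrot
  by_cases hj₂ : 2 * j ≤ U.length
  · exact ⟨f, ⟨hf, hf₁⟩, G.length, by omega, j, by omega, rfl, by omega, G, U, rfl,
      hdecomp.symm, hjU.symm⟩
  · refine ⟨f⁻¹, ⟨fun a => ?_, inv_ne_one.2 hf₁⟩, G.length, by omega, U.length - j, by omega,
      rfl, by omega, G, U, rfl, hdecomp.symm, ?_⟩
    · rw [Equiv.Perm.inv_eq_iff_eq, hf]
      exact congrArg letterInv (f.apply_symm_apply a).symm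
    · have h₁ : (U.map ⇑f⁻¹).rotate j = U := by
        rw [← List.map_rotate, hjU, List.map_map]
        simp [Function.comp_def]
      conv_rhs => rw [← h₁, List.rotate_rotate, List.length_rotate, List.length_map,
        Nat.add_sub_cancel' hj]
      rw [← List.length_map (f := ⇑f⁻¹), List.rotate_length]

theorem finite_ballF (X : Type) [Finite X] [DecidableEq X] (n : ℕ) : (ballF X n).Finite :=
  (List.finite_length_le (X × Bool) n).preimage FreeGroup.toWord_injective.injOn

open FreeGroup in
theorem pow_le_ncard_ballF {X : Type} [Fintype X] [DecidableEq X] {q : ℕ}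
    (hcard : Fintype.card (X × Bool) = q + 2) (n : ℕ) : (q + 1) ^ n ≤ (ballF X n).ncard := by
  obtain ⟨S, hS, hSc⟩ := exists_reduced_words hcard n
  refine hSc.trans ?_
  rw [← Set.ncard_coe_finset]
  refine Set.ncard_le_ncard_of_injOn mk (fun L hL => ?_) (fun L hL M hM h => ?_)
    (finite_ballF X n)
  · exact norm_mk_le.trans (hS L hL).2.le
  · exact (hS L hL).1.eq_of_mk_eq (hS M hM).1 h

open FreeGroup in
theorem ncard_typeI_conj_inter_ballF_le {X : Type} [Fintype X] [DecidableEq X] {q : ℕ}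
    (hq : 2 ≤ q) (hcard : Fintype.card (X × Bool) = q + 2) (n : ℕ) :
    ({w : FreeGroup X | ∃ σ : MulAut (FreeGroup X), IsTypeI σ ∧ σ ≠ 1 ∧ IsConj w (σ w)} ∩
      ballF X n).ncard ≤ Fintype.card (Equiv.Perm (X × Bool)) * (n + 1) ^ 3 * q ^ n := by
  classical
  let I : Finset (Equiv.Perm (X × Bool) × ℕ × ℕ × ℕ) :=
    (Finset.univ.filter fun f => (∀ a, f (letterInv a) = letterInv (f a)) ∧ f ≠ 1) ×ˢ
      Finset.range (n + 1) ×ˢ Finset.range (n + 1) ×ˢ Finset.range (n + 1)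
  let E : Equiv.Perm (X × Bool) × ℕ × ℕ × ℕ → Set (List (X × Bool)) :=
    fun p => twistedWords p.1 p.2.1 p.2.2.1 p.2.2.2
  have hfin : (⋃ p ∈ I, E p).Finite := I.finite_toSet.biUnion fun p _ =>
    (List.finite_length_eq (X × Bool) p.2.1).subset fun W hW => hW.1
  calc _ ≤ (⋃ p ∈ I, E p).ncard := by
        refine Set.ncard_le_ncard_of_injOn toWord ?_ toWord_injective.injOn hfin
        rintro w ⟨⟨σ, hσ, hσ₁, hw⟩, hwn⟩
        obtain ⟨f, hf, k, hk, i, hi, hmem⟩ := hσ.exists_mem_twistedWords hσ₁ hw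
        have hwn' : w.norm ≤ n := hwn
        refine Set.mem_biUnion (x := (f, w.norm, k, i)) ?_ hmem
        simp only [I, Finset.mem_coe, Finset.mem_product, Finset.mem_filter, Finset.mem_univ,
          true_and, Finset.mem_range]
        exact ⟨hf, by omega, by omega, by omega⟩
    _ ≤ ∑ p ∈ I, (E p).ncard := I.set_ncard_biUnion_le E
    _ ≤ ∑ p ∈ I, q ^ n := by
        refine Finset.sum_le_sum fun p hp => ?_
        simp only [I, Finset.mem_product, Finset.mem_filter, Finset.mem_univ, true_and,
          Finset.mem_range] at hp
        exact (ncard_twistedWords_le hp.1.1 hp.1.2 hq hcard _ _ _).trans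
          (Nat.pow_le_pow_right (by omega) (by omega))
    _ = I.card * q ^ n := by rw [Finset.sum_const, smul_eq_mul]
    _ ≤ Fintype.card (Equiv.Perm (X × Bool)) * (n + 1) ^ 3 * q ^ n := by
        gcongr
        simp only [I, Finset.card_product, Finset.card_range]
        rw [pow_succ', pow_two]
        gcongr
        exact Finset.card_le_univ _

/-- the set of w ∈ F(X) such that σ(w) is conjugate to w for some
non-identity type I Whitehead automorphism σ is exponentially F(X)-negligible. -/
theorem statement15 (X : Type) [Fintype X] [DecidableEq X] (hX : 2 ≤ Fintype.card X) :
    ExpGeneric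
      (Set.univ \ {w : FreeGroup X | ∃ σ : MulAut (FreeGroup X),
        IsTypeI σ ∧ σ ≠ 1 ∧ IsConj w (σ w)})
      (Set.univ : Set (FreeGroup X)) := by
  obtain ⟨q, hq, hcard⟩ : ∃ q, 2 ≤ q ∧ Fintype.card (X × Bool) = q + 2 := by
    refine ⟨2 * Fintype.card X - 2, by omega, ?_⟩
    rw [Fintype.card_prod, Fintype.card_bool]
    omega
  have hq₀ : (0 : ℝ) < q := by positivity
  obtain ⟨C, hC, s, hs₀, hs₁, hbound⟩ := exists_succ_pow_mul_pow_le 3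
    (r := (q : ℝ) / (q + 1)) (by positivity) ((div_lt_one (by positivity)).2 (by linarith))
  have hM : 0 < Fintype.card (Equiv.Perm (X × Bool)) := Fintype.card_pos
  refine ⟨Fintype.card (Equiv.Perm (X × Bool)) * C, by positivity, s, hs₀, hs₁, fun n => ?_⟩
  rw [Set.sdiff_sdiff_cancel_left (Set.subset_univ _), Set.univ_inter]
  have hupper : (_ : ℝ) ≤ _ := Nat.cast_le.2 (ncard_typeI_conj_inter_ballF_le hq hcard n)
  have hlower : (_ : ℝ) ≤ _ := Nat.cast_le.2 (pow_le_ncard_ballF hcard n)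
  push_cast at hupper hlower
  calc _ ≤ _ := hupper
    _ = Fintype.card (Equiv.Perm (X × Bool)) *
        (((n : ℝ) + 1) ^ 3 * ((q : ℝ) / (q + 1)) ^ n) * ((q : ℝ) + 1) ^ n := by
      rw [div_pow]
      field_simp
    _ ≤ Fintype.card (Equiv.Perm (X × Bool)) * (C * s ^ n) * (ballF X n).ncard := by
      gcongr ?_ * ?_ * ?_
      · exact hbound n
    _ = _ := by ring
end
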